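/- Suppose ε_r⁻¹ satisfies the non-trapping assumptions (a), (b), (c). Then the homogeneous scattering problem has only the trivial solution: every homogeneous radiating solution H vanishes identically in Ω. (This holds for every wave number k > 0.) -/

import Mathlib

open MeasureTheory Real

noncomputable section

abbrev R3 : Type := Fin 3 → ℝ
abbrev C3 : Type := Fin 3 → ℂ

/-- Partial derivative of a complex-valued function on `ℝ³`. -/
def pdC (i : Fin 3) (f : R3 → ℂ) (x : R3) : ℂ := fderiv ℝ f x (Pi.single i 1)

/-- Partial derivative of a real-valued function on `ℝ³`. -/
def pdR (i : Fin 3) (f : R3 → ℝ) (x : R3) : ℝ := fderiv ℝ f x (Pi.single i 1)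

/-- The shifted partial derivative `∂^α f/∂x_i = ∂f/∂x_i + i α_i f`. -/
def pdA (α : R3) (i : Fin 3) (f : R3 → ℂ) (x : R3) : ℂ :=
  pdC i f x + Complex.I * (α i : ℂ) * f x

/-- Componentwise partial derivative of a vector field. -/
def pdV (i : Fin 3) (F : R3 → C3) (x : R3) : C3 := fun j => pdC i (fun y => F y j) x

def realToC3 (a : R3) : C3 := fun i => (a i : ℂ)

/-- Cross product of complex 3-vectors. -/
def crossC (a b : C3) : C3 :=
  ![a 1 * b 2 - a 2 * b 1, a 2 * b 0 - a 0 * b 2, a 0 * b 1 - a 1 * b 0]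

/-- Cross product of real 3-vectors. -/
def crossR (a b : R3) : R3 :=
  ![a 1 * b 2 - a 2 * b 1, a 2 * b 0 - a 0 * b 2, a 0 * b 1 - a 1 * b 0]

/-- The unit vector `e₃ = (0,0,1)` as a complex vector. -/
def e3 : C3 := ![0, 0, 1]

/-- `ã = (a₁,a₂,−a₃)`. -/
def tld (a : R3) : R3 := ![a 0, a 1, -(a 2)]

/-- The curl of a complex vector field on `ℝ³`. -/
def curlF (F : R3 → C3) (x : R3) : C3 :=
  ![pdC 1 (fun y => F y 2) x - pdC 2 (fun y => F y 1) x,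
    pdC 2 (fun y => F y 0) x - pdC 0 (fun y => F y 2) x,
    pdC 0 (fun y => F y 1) x - pdC 1 (fun y => F y 0) x]

/-- `curl_α F = curl F + i α × F`. -/
def curlA (α : R3) (F : R3 → C3) (x : R3) : C3 :=
  curlF F x + Complex.I • crossC (realToC3 α) (F x)

/-- The divergence of a complex vector field. -/
def divFld (F : R3 → C3) (x : R3) : ℂ := ∑ i, pdC i (fun y => F y i) x

/-- `div_α F = div F + i α · F`. -/
def divA (α : R3) (F : R3 → C3) (x : R3) : ℂ :=
  divFld F x + Complex.I * ∑ i, (α i : ℂ) * F x i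

/-- Squared Euclidean norm of a complex 3-vector. -/
def nsq (v : C3) : ℝ := ∑ i, Complex.normSq (v i)

/-- `a · conj b` for complex 3-vectors. -/
def dotc (a b : C3) : ℂ := ∑ i, a i * (starRingEnd ℂ) (b i)

/-- Plain (bilinear) dot product of complex 3-vectors. -/
def dotp (a b : C3) : ℂ := ∑ i, a i * b i

/-- Componentwise complex conjugate of a vector. -/
def conjV (v : C3) : C3 := fun i => (starRingEnd ℂ) (v i)

/-- Transverse part `(v₁, v₂, 0)` of a vector. -/
def vecT (v : C3) : C3 := ![v 0, v 1, 0]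

/-- The periodicity cell `Ω = (0,2π)² × (0,h)`. -/
def Omg (h : ℝ) : Set R3 :=
  {x | x 0 ∈ Set.Ioo 0 (2 * π) ∧ x 1 ∈ Set.Ioo 0 (2 * π) ∧ x 2 ∈ Set.Ioo 0 h}

/-- The square `(0,2π)²` parametrizing the horizontal boundary faces. -/
def sq2 : Set (ℝ × ℝ) := Set.Ioo 0 (2 * π) ×ˢ Set.Ioo 0 (2 * π)

/-- The point `(p₁, p₂, t) ∈ ℝ³`. -/
def bpt (p : ℝ × ℝ) (t : ℝ) : R3 := ![p.1, p.2, t]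

/-- `2π`-periodicity in the first two variables. -/
def Biperiodic {E : Type*} (f : R3 → E) : Prop :=
  ∀ x : R3, f (x + (2 * π) • (Pi.single 0 1 : R3)) = f x ∧ f (x + (2 * π) • (Pi.single 1 1 : R3)) = f x

/-- Fourier coefficient of order `n ∈ ℤ²` of `H(·,·,t)` on the square `(0,2π)²`. -/
def fcoeff (H : R3 → C3) (n : ℤ × ℤ) (t : ℝ) : C3 := fun j =>
  (1 / (4 * (π : ℂ) ^ 2)) *
    ∫ p in sq2, H (bpt p t) j *
      Complex.exp (-Complex.I * (((n.1 : ℝ) * p.1 + (n.2 : ℝ) * p.2 : ℝ) : ℂ))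

/-- `β_n = √(k²−|n+α|²)` if `k² ≥ |n+α|²`, and `i √(|n+α|²−k²)` otherwise. -/
def betaN (k : ℝ) (α : R3) (n : ℤ × ℤ) : ℂ :=
  if ((n.1 : ℝ) + α 0) ^ 2 + ((n.2 : ℝ) + α 1) ^ 2 ≤ k ^ 2 then
    ((Real.sqrt (k ^ 2 - (((n.1 : ℝ) + α 0) ^ 2 + ((n.2 : ℝ) + α 1) ^ 2)) : ℝ) : ℂ)
  else
    Complex.I * ((Real.sqrt ((((n.1 : ℝ) + α 0) ^ 2 + ((n.2 : ℝ) + α 1) ^ 2) - k ^ 2) : ℝ) : ℂ)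

/-- The exterior Dirichlet-to-Neumann operator `T_α` applied to the `j`-th component of
the trace of `H` on `Γ_h`, evaluated at the boundary point `(p₁,p₂,h)`. -/
def Talpha (k : ℝ) (α : R3) (H : R3 → C3) (h : ℝ) (j : Fin 3) (p : ℝ × ℝ) : ℂ :=
  ∑' n : ℤ × ℤ, Complex.I * betaN k α n * fcoeff H n h j *
    Complex.exp (Complex.I * (((n.1 : ℝ) * p.1 + (n.2 : ℝ) * p.2 : ℝ) : ℂ))

/-- Standing hypotheses on `ε_r⁻¹`: `C¹`, biperiodic, positive and bounded away from
zero, and equal to `1` near `Γ_h`. -/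
structure EpsOK (h : ℝ) (εinv : R3 → ℝ) : Prop where
  smooth : ContDiff ℝ 1 εinv
  periodic : Biperiodic εinv
  pos : ∃ c : ℝ, 0 < c ∧ ∀ x, c ≤ εinv x
  one_near_top : ∃ η : ℝ, 0 < η ∧ η < h ∧ ∀ x : R3, h - η < x 2 → εinv x = 1

/-- A homogeneous radiating solution of the biperiodic scattering problem. -/
structure IsHomSol (h k : ℝ) (α : R3) (εinv : R3 → ℝ) (H : R3 → C3) : Prop where
  smooth : ContDiff ℝ 2 H
  periodic : Biperiodic H
  maxwell : ∀ x ∈ Omg h, curlA α (fun y => (εinv y : ℂ) • curlA α H y) x = (k ^ 2 : ℂ) • H x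
  divfree : ∀ x ∈ Omg h, divA α H x = 0
  bc_normal : ∀ x : R3, x 2 = 0 → H x 2 = 0
  bc_tangential : ∀ x : R3, x 2 = 0 → crossC e3 ((εinv x : ℂ) • curlA α H x) = 0
  radiation : ∀ n : ℤ × ℤ, ∀ j : Fin 3,
    deriv (fun t => fcoeff H n t j) h = Complex.I * betaN k α n * fcoeff H n h j

/-- The non-trapping assumptions (a), (b), (c) on `ε_r⁻¹`. -/
def NonTrapping (h : ℝ) (εinv : R3 → ℝ) : Prop :=
  (∀ x ∈ Omg h, pdR 2 εinv x ≤ 0) ∧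
  (∃ U : Set R3, IsOpen U ∧ U.Nonempty ∧ U ⊆ Omg h ∧ ∀ x ∈ U, pdR 2 εinv x < 0) ∧
  (∃ δ : ℝ, 1 / 2 < δ ∧ ∃ Mt Mz : ℝ,
    (∀ x ∈ Omg h, (pdR 0 εinv x) ^ 2 + (pdR 1 εinv x) ^ 2 ≤ Mt ^ 2) ∧
    (∀ x ∈ Omg h, |pdR 2 εinv x| ≤ Mz) ∧
    δ / 2 * Mt ^ 2 + Real.sqrt 2 / h * Mz < 2 / h ^ 2)

section FourierSquare

open ComplexConjugate

local instance unitAddCircleHaarMeasureSpace : MeasureSpace UnitAddCircle :=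
  ⟨AddCircle.haarAddCircle⟩

local instance unitAddCircle_isProbabilityMeasure :
    IsProbabilityMeasure (volume : Measure UnitAddCircle) :=
  inferInstanceAs (IsProbabilityMeasure AddCircle.haarAddCircle)

/-- The representative in `(0,2π]²` of a point of the two-dimensional torus. -/
def torusRep (y : UnitAddTorus (Fin 2)) : ℝ × ℝ :=
  (2 * π * (AddCircle.equivIoc 1 0 (y 0)).1, 2 * π * (AddCircle.equivIoc 1 0 (y 1)).1)

theorem measurable_torusRep : Measurable torusRep := by
  have key : ∀ i : Fin 2, Measurable fun y : UnitAddTorus (Fin 2) =>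
      2 * π * (AddCircle.equivIoc 1 0 (y i)).1 := fun i =>
    ((measurable_subtype_coe.comp
      ((AddCircle.measurableEquivIoc 1 0).measurable.comp (measurable_pi_apply i))).const_mul _)
  exact (key 0).prodMk (key 1)

open scoped Pointwise in
theorem integral_torusRep (Φ : ℝ × ℝ → ℂ) :
    ∫ y, Φ (torusRep y) = (1 / (4 * (π : ℂ) ^ 2)) * ∫ p in sq2, Φ p := by
  have hpi : (0 : ℝ) < 2 * π := by positivity
  rw [UnitAddTorus.integral_preimage _ (0 : Fin 2 → ℝ)]
  have hS : MeasurableSet {x : Fin 2 → ℝ | ∀ i, x i ∈ Set.Ioc ((0 : Fin 2 → ℝ) i)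
      ((0 : Fin 2 → ℝ) i + 1)} := MeasurableSet.univ_pi' (fun i => measurableSet_Ioc)
  have h1 : ∫ x in {x : Fin 2 → ℝ | ∀ i, x i ∈ Set.Ioc ((0 : Fin 2 → ℝ) i)
      ((0 : Fin 2 → ℝ) i + 1)}, Φ (torusRep fun i => (x i : UnitAddCircle)) =
      ∫ x in {x : Fin 2 → ℝ | ∀ i, x i ∈ Set.Ioc ((0 : Fin 2 → ℝ) i)
      ((0 : Fin 2 → ℝ) i + 1)}, Φ (2 * π * x 0, 2 * π * x 1) := by
    refine setIntegral_congr_fun hS fun x hx => ?_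
    have h (i : Fin 2) : ((AddCircle.equivIoc 1 0 (x i : UnitAddCircle)).1 : ℝ) = x i :=
      AddCircle.equivIoc_coe_of_mem (hx i)
    simp only [torusRep, h]
  rw [h1]
  have h2 : {x : Fin 2 → ℝ | ∀ i, x i ∈ Set.Ioc ((0 : Fin 2 → ℝ) i) ((0 : Fin 2 → ℝ) i + 1)} =
      MeasurableEquiv.finTwoArrow ⁻¹' (Set.Ioc (0 : ℝ) 1 ×ˢ Set.Ioc (0 : ℝ) 1) := by
    ext x; simp [Fin.forall_fin_two]
  have h3 := (volume_preserving_finTwoArrow ℝ).setIntegral_preimage_emb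
    MeasurableEquiv.finTwoArrow.measurableEmbedding
    (fun q : ℝ × ℝ => Φ ((2 * π) • q)) (Set.Ioc (0 : ℝ) 1 ×ˢ Set.Ioc (0 : ℝ) 1)
  have h4 : (2 * π) • (Set.Ioc (0 : ℝ) 1 ×ˢ Set.Ioc (0 : ℝ) 1) =
      Set.Ioc 0 (2 * π) ×ˢ Set.Ioc 0 (2 * π) := by
    ext ⟨a, b⟩
    rw [Set.mem_smul_set_iff_inv_smul_mem₀ hpi.ne']
    simp only [Prod.smul_mk, smul_eq_mul, Set.mem_prod, Set.mem_Ioc, inv_mul_le_one₀ hpi,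
      mul_pos_iff_of_pos_left (inv_pos.2 hpi)]
  have h5 : (sq2 : Set (ℝ × ℝ)) =ᵐ[volume] Set.Ioc 0 (2 * π) ×ˢ Set.Ioc 0 (2 * π) :=
    Measure.set_prod_ae_eq Ioo_ae_eq_Ioc Ioo_ae_eq_Ioc
  rw [Measure.setIntegral_comp_smul volume Φ _ hpi.ne', h4, ← setIntegral_congr_set h5] at h3
  rw [h2]
  refine h3.trans ?_
  simp only [Module.finrank_prod, Module.finrank_self, Complex.real_smul]
  rw [abs_of_nonneg (by positivity)]
  push_cast
  ring

/-- Fourier coefficient on the square `(0,2π)²`. -/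
def sqCoeff (n : ℤ × ℤ) (F : ℝ × ℝ → ℂ) : ℂ :=
  (1 / (4 * (π : ℂ) ^ 2)) *
    ∫ p in sq2, F p * Complex.exp (-Complex.I * (((n.1 : ℝ) * p.1 + (n.2 : ℝ) * p.2 : ℝ) : ℂ))

theorem memLp_comp_torusRep {F : ℝ × ℝ → ℂ} (hF : Continuous F) :
    MemLp (fun y => F (torusRep y)) 2 (volume : Measure (UnitAddTorus (Fin 2))) := by
  obtain ⟨C, hC⟩ := ((isCompact_Icc (a := (0 : ℝ)) (b := 2 * π)).prod
    (isCompact_Icc (a := (0 : ℝ)) (b := 2 * π))).exists_bound_of_continuousOn hF.continuousOn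
  refine MemLp.of_bound (hF.measurable.comp measurable_torusRep).aestronglyMeasurable C
    (Filter.Eventually.of_forall fun y => hC _ ?_)
  have key (z : UnitAddCircle) : 2 * π * (AddCircle.equivIoc 1 0 z).1 ∈ Set.Icc 0 (2 * π) := by
    have := (AddCircle.equivIoc 1 0 z).2
    have hpi := Real.pi_pos
    constructor <;> nlinarith [this.1, this.2]
  exact ⟨key _, key _⟩

theorem mFourier_eq_exp_torusRep (n : Fin 2 → ℤ) (y : UnitAddTorus (Fin 2)) :
    UnitAddTorus.mFourier (-n) y = Complex.exp (-Complex.I *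
      (((n 0 : ℝ) * (torusRep y).1 + (n 1 : ℝ) * (torusRep y).2 : ℝ) : ℂ)) := by
  have key (m : ℤ) (z : UnitAddCircle) : fourier (-m) z =
      Complex.exp (-Complex.I * ((m : ℝ) * (2 * π * (AddCircle.equivIoc 1 0 z).1) : ℝ)) := by
    have hz : (((AddCircle.equivIoc 1 0 z).1 : ℝ) : UnitAddCircle) = z :=
      (AddCircle.equivIoc 1 0).symm_apply_apply z
    conv_lhs => rw [← hz]
    rw [fourier_coe_apply]
    congr 1
    push_cast
    ring
  simp only [UnitAddTorus.mFourier, ContinuousMap.coe_mk, Fin.prod_univ_two, Pi.neg_apply, key,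
    ← Complex.exp_add, torusRep]
  congr 1
  push_cast
  ring

theorem mFourierCoeff_comp_torusRep (F : ℝ × ℝ → ℂ) (n : Fin 2 → ℤ) :
    UnitAddTorus.mFourierCoeff (fun y => F (torusRep y)) n = sqCoeff (n 0, n 1) F := by
  rw [sqCoeff, ← integral_torusRep, UnitAddTorus.mFourierCoeff]
  simp only [mFourier_eq_exp_torusRep, smul_eq_mul, mul_comm]

/-- Parseval's identity for continuous functions on the square. -/
theorem hasSum_sqCoeff_mul_conj {F G : ℝ × ℝ → ℂ} (hF : Continuous F) (hG : Continuous G) :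
    HasSum (fun n => sqCoeff n F * conj (sqCoeff n G))
      ((1 / (4 * (π : ℂ) ^ 2)) * ∫ p in sq2, F p * conj (G p)) := by
  have hf := memLp_comp_torusRep hF
  have hg := memLp_comp_torusRep hG
  have key := UnitAddTorus.hasSum_prod_mFourierCoeff (hg.toLp _) (hf.toLp _)
  have coeff {K : ℝ × ℝ → ℂ} (hK : MemLp (fun y => K (torusRep y)) 2
      (volume : Measure (UnitAddTorus (Fin 2)))) (n : Fin 2 → ℤ) :
      UnitAddTorus.mFourierCoeff (hK.toLp _) n = sqCoeff (n 0, n 1) K := by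
    rw [← mFourierCoeff_comp_torusRep, UnitAddTorus.mFourierCoeff, UnitAddTorus.mFourierCoeff]
    refine integral_congr_ae ?_
    filter_upwards [hK.coeFn_toLp] with y hy
    rw [hy]
  have hint : ∫ y, conj (hg.toLp _ y) * hf.toLp _ y =
      (1 / (4 * (π : ℂ) ^ 2)) * ∫ p in sq2, F p * conj (G p) := by
    rw [← integral_torusRep fun p => F p * conj (G p)]
    refine integral_congr_ae ?_
    filter_upwards [hf.coeFn_toLp, hg.coeFn_toLp] with y hy1 hy2
    rw [hy1, hy2, mul_comm]
  rw [hint] at key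
  simp only [coeff, mul_comm (conj _)] at key
  exact (Equiv.hasSum_iff (finTwoArrowEquiv ℤ) (f := fun n : ℤ × ℤ =>
    sqCoeff n F * conj (sqCoeff n G))).1 key

end FourierSquare

section Cell

/-- The closed periodicity cell `[0,2π]² × [0,h]`. -/
def closedCell (h : ℝ) : Set R3 := Set.Icc 0 ![2 * π, 2 * π, h]

theorem mem_closedCell {h : ℝ} {x : R3} : x ∈ closedCell h ↔
    x 0 ∈ Set.Icc 0 (2 * π) ∧ x 1 ∈ Set.Icc 0 (2 * π) ∧ x 2 ∈ Set.Icc 0 h := by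
  simp only [closedCell, Set.mem_Icc, Pi.le_def, Fin.forall_fin_succ, Pi.zero_apply]
  simp
  tauto

theorem Omg_eq_pi (h : ℝ) : Omg h = Set.pi Set.univ
    fun i => Set.Ioo ((0 : R3) i) ((![2 * π, 2 * π, h] : R3) i) := by
  ext x
  simp [Omg, Set.mem_pi, Fin.forall_fin_succ]

theorem isOpen_Omg (h : ℝ) : IsOpen (Omg h) := by
  rw [Omg_eq_pi]
  exact isOpen_set_pi Set.finite_univ fun _ _ => isOpen_Ioo

theorem closure_Omg {h : ℝ} (hh : 0 < h) : closure (Omg h) = closedCell h := by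
  have hpi : (0 : ℝ) ≠ 2 * π := by positivity
  rw [Omg_eq_pi, closure_pi_set, closedCell, ← Set.pi_univ_Icc]
  congr 1
  funext i
  refine closure_Ioo ?_
  fin_cases i <;> simp [hh.ne]

theorem Omg_subset_closedCell (h : ℝ) : Omg h ⊆ closedCell h := fun _ hx =>
  mem_closedCell.2 ⟨Set.Ioo_subset_Icc_self hx.1, Set.Ioo_subset_Icc_self hx.2.1,
    Set.Ioo_subset_Icc_self hx.2.2⟩

theorem Omg_ae_eq_closedCell (h : ℝ) : Omg h =ᵐ[volume] closedCell h := by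
  rw [Omg_eq_pi, volume_pi]
  exact Measure.univ_pi_Ioo_ae_eq_Icc

theorem isCompact_closedCell (h : ℝ) : IsCompact (closedCell h) := isCompact_Icc

theorem measurableSet_sq2 : MeasurableSet sq2 := measurableSet_Ioo.prod measurableSet_Ioo

theorem sq2_ae_eq_Icc : (sq2 : Set (ℝ × ℝ)) =ᵐ[volume]
    Set.Icc ((0 : ℝ), (0 : ℝ)) (2 * π, 2 * π) := by
  rw [← Set.Icc_prod_Icc]
  exact Measure.set_prod_ae_eq Ioo_ae_eq_Icc Ioo_ae_eq_Icc

theorem Continuous.integrableOn_sq2 {E : Type*} [NormedAddCommGroup E] {g : ℝ × ℝ → E}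
    (hg : Continuous g) : IntegrableOn g sq2 := by
  rw [integrableOn_congr_set_ae sq2_ae_eq_Icc]
  exact hg.continuousOn.integrableOn_compact isCompact_Icc

theorem continuous_bpt : Continuous fun q : (ℝ × ℝ) × ℝ => bpt q.1 q.2 := by
  refine continuous_pi fun i => ?_
  fin_cases i <;> simp [bpt] <;> fun_prop

theorem contDiff_bpt (t : ℝ) {n : WithTop ℕ∞} : ContDiff ℝ n fun p : ℝ × ℝ => bpt p t := by
  refine contDiff_pi.2 fun i => ?_
  fin_cases i <;> simp [bpt] <;> fun_prop

theorem continuous_bpt_left (t : ℝ) : Continuous fun p : ℝ × ℝ => bpt p t :=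
  (contDiff_bpt t (n := 1)).continuous

theorem Biperiodic.bpt_right {E : Type*} {f : R3 → E} (hf : Biperiodic f) (a b t : ℝ) :
    f (bpt (a + 2 * π, b) t) = f (bpt (a, b) t) ∧ f (bpt (a, b + 2 * π) t) = f (bpt (a, b) t) := by
  constructor
  · rw [← (hf (bpt (a, b) t)).1]
    congr 1
    ext i
    fin_cases i <;> simp [bpt]
  · rw [← (hf (bpt (a, b) t)).2]
    congr 1
    ext i
    fin_cases i <;> simp [bpt]

/-- Divergence theorem on the periodicity cell: the lateral faces do not contribute. -/
theorem integral_div_cell {E : Type*} [NormedAddCommGroup E] [NormedSpace ℝ E] {h : ℝ}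
    (hh : 0 < h) (Φ : Fin 3 → R3 → E) (f : R3 → E)
    (hc : ∀ i, ContinuousOn (Φ i) (closedCell h))
    (hd : ∀ i, ∀ x ∈ Omg h, DifferentiableAt ℝ (Φ i) x)
    (hdiv : ∀ x ∈ Omg h, ∑ i, fderiv ℝ (Φ i) x (Pi.single i 1) = f x)
    (hf : ContinuousOn f (closedCell h)) (h0 : Biperiodic (Φ 0)) (h1 : Biperiodic (Φ 1)) :
    ∫ x in Omg h, f x = (∫ p in sq2, Φ 2 (bpt p h)) - ∫ p in sq2, Φ 2 (bpt p 0) := by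
  have hle : (0 : R3) ≤ ![2 * π, 2 * π, h] := by
    intro i
    fin_cases i <;> simp [hh.le, Real.pi_pos.le]
  have hmeas : MeasurableSet (Omg h) := (isOpen_Omg h).measurableSet
  have hint : IntegrableOn (fun x => ∑ i, fderiv ℝ (Φ i) x (Pi.single i 1)) (closedCell h) := by
    have h2 : IntegrableOn f (Omg h) :=
      (hf.integrableOn_compact (isCompact_closedCell h)).mono_set (Omg_subset_closedCell h)
    rw [← integrableOn_congr_set_ae (Omg_ae_eq_closedCell h)]
    exact h2.congr_fun (fun x hx => (hdiv x hx).symm) hmeas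
  have key := integral_divergence_of_hasFDerivAt_off_countable' (0 : R3) ![2 * π, 2 * π, h] hle Φ
    (fun i => fderiv ℝ (Φ i)) ∅ Set.countable_empty hc
    (fun x hx i => (hd i x (by rw [Omg_eq_pi]; exact hx.1)).hasFDerivAt) hint
  have face (t : ℝ) : ∫ x in Set.Icc ((0 : R3) ∘ Fin.succAbove 2)
      ((![2 * π, 2 * π, h] : R3) ∘ Fin.succAbove 2), Φ 2 (Fin.insertNth (2 : Fin 3) t x) =
      ∫ p in sq2, Φ 2 (bpt p t) := by
    have h3 := (volume_preserving_finTwoArrow ℝ).setIntegral_preimage_emb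
      MeasurableEquiv.finTwoArrow.measurableEmbedding
      (fun p : ℝ × ℝ => Φ 2 (bpt p t)) (Set.Icc (0, 0) (2 * π, 2 * π))
    rw [setIntegral_congr_set sq2_ae_eq_Icc, ← h3]
    congr 1
    · congr 1
      ext x
      simp only [Set.mem_Icc, Pi.le_def, Fin.forall_fin_two, Set.mem_preimage, Prod.le_def]
      rfl
    · funext x
      congr 1
      ext i
      fin_cases i <;> rfl
  have e0 : ∀ x : Fin 2 → ℝ, Φ 0 (Fin.insertNth (0 : Fin 3) (2 * π) x) =
      Φ 0 (Fin.insertNth (0 : Fin 3) 0 x) := fun x => by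
    convert (h0.bpt_right 0 (x 0) (x 1)).1 using 2
    all_goals
      ext i
      fin_cases i <;> simp [bpt]
      all_goals rfl
  have e1 : ∀ x : Fin 2 → ℝ, Φ 1 (Fin.insertNth (1 : Fin 3) (2 * π) x) =
      Φ 1 (Fin.insertNth (1 : Fin 3) 0 x) := fun x => by
    convert (h1.bpt_right (x 0) 0 (x 1)).2 using 2
    all_goals
      ext i
      fin_cases i <;> simp [bpt]
      all_goals rfl
  rw [← setIntegral_congr_fun hmeas hdiv, setIntegral_congr_set (Omg_ae_eq_closedCell h)]
  refine key.trans ?_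
  rw [Fin.sum_univ_three, ← face h, ← face 0]
  simp only [Matrix.cons_val_zero, Matrix.cons_val_one, Matrix.cons_val, e0, e1, sub_self, zero_add,
    Pi.zero_apply]

end Cell

section FourierDerivatives

theorem integral_sq2_fderiv {g : ℝ × ℝ → ℂ} (hg : ContDiff ℝ 1 g)
    (h1 : ∀ a b, g (a + 2 * π, b) = g (a, b)) (h2 : ∀ a b, g (a, b + 2 * π) = g (a, b)) :
    ∫ p in sq2, fderiv ℝ g p (1, 0) = 0 ∧ ∫ p in sq2, fderiv ℝ g p (0, 1) = 0 := by
  have hd (x : ℝ × ℝ) : HasFDerivAt g (fderiv ℝ g x) x :=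
    (hg.differentiable one_ne_zero x).hasFDerivAt
  have hle : ((0 : ℝ), (0 : ℝ)) ≤ (2 * π, 2 * π) := by
    constructor <;> simp [Real.pi_pos.le]
  have hcf := hg.continuous_fderiv one_ne_zero
  have key1 := integral_divergence_prod_Icc_of_hasFDerivAt_of_le g (fun _ => 0)
    (fderiv ℝ g) (fun _ => 0) (0, 0) (2 * π, 2 * π) hle hg.continuous.continuousOn
    continuousOn_const (fun x _ => hd x) (fun x _ => hasFDerivAt_const _ _)
    (by
      refine ContinuousOn.integrableOn_compact isCompact_Icc (Continuous.continuousOn ?_)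
      simp only [_root_.zero_apply, add_zero]
      fun_prop)
  have key2 := integral_divergence_prod_Icc_of_hasFDerivAt_of_le (fun _ => 0) g
    (fun _ => 0) (fderiv ℝ g) (0, 0) (2 * π, 2 * π) hle
    continuousOn_const hg.continuous.continuousOn (fun x _ => hasFDerivAt_const _ _)
    (fun x _ => hd x)
    (by
      refine ContinuousOn.integrableOn_compact isCompact_Icc (Continuous.continuousOn ?_)
      simp only [_root_.zero_apply, zero_add]
      fun_prop)
  have p1 (b : ℝ) : g (2 * π, b) = g (0, b) := by simpa using h1 0 b
  have p2 (a : ℝ) : g (a, 2 * π) = g (a, 0) := by simpa using h2 a 0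
  rw [setIntegral_congr_set sq2_ae_eq_Icc, setIntegral_congr_set sq2_ae_eq_Icc]
  constructor
  · simpa [p1] using key1
  · simpa [p2] using key2

theorem exp_fourier_add_two_pi (m : ℤ) (z : ℂ) :
    Complex.exp (z + -Complex.I * (m * (2 * π))) = Complex.exp z := by
  have := Complex.exp_periodic.int_mul (-m) z
  rw [← this]
  congr 1
  push_cast
  ring

theorem sqCoeff_pdC {F : R3 → ℂ} (hF : ContDiff ℝ 1 F) (hp : Biperiodic F) (n : ℤ × ℤ) (t : ℝ) :
    sqCoeff n (fun p => pdC 0 F (bpt p t)) =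
      Complex.I * n.1 * sqCoeff n (fun p => F (bpt p t)) ∧
    sqCoeff n (fun p => pdC 1 F (bpt p t)) =
      Complex.I * n.2 * sqCoeff n (fun p => F (bpt p t)) := by
  set e : ℝ × ℝ → ℂ := fun p =>
    Complex.exp (-Complex.I * (((n.1 : ℝ) * p.1 + (n.2 : ℝ) * p.2 : ℝ) : ℂ)) with he
  have hec : ContDiff ℝ 1 e := by
    exact Complex.contDiff_exp.comp (contDiff_const.mul (Complex.ofRealCLM.contDiff.comp
      ((contDiff_const.mul contDiff_fst).add (contDiff_const.mul contDiff_snd))))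
  have hFb : ContDiff ℝ 1 fun p : ℝ × ℝ => F (bpt p t) := hF.comp (contDiff_bpt t)
  have hded (v : ℝ × ℝ) (p : ℝ × ℝ) : fderiv ℝ e p v =
      -Complex.I * ((n.1 : ℝ) * v.1 + (n.2 : ℝ) * v.2 : ℝ) * e p := by
    have h1 : HasFDerivAt (fun p : ℝ × ℝ => (n.1 : ℝ) * p.1 + (n.2 : ℝ) * p.2)
        ((n.1 : ℝ) • ContinuousLinearMap.fst ℝ ℝ ℝ + (n.2 : ℝ) • ContinuousLinearMap.snd ℝ ℝ ℝ) p :=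
      (hasFDerivAt_fst.const_mul _).add (hasFDerivAt_snd.const_mul _)
    have h2 := ((Complex.ofRealCLM.hasFDerivAt.comp p h1).const_mul (-Complex.I)).cexp
    have h3 := h2.fderiv
    rw [show e = _ from he, show (fun p : ℝ × ℝ => Complex.exp (-Complex.I *
      (((n.1 : ℝ) * p.1 + (n.2 : ℝ) * p.2 : ℝ) : ℂ))) = _ from rfl]
    erw [h3]
    simp
    ring
  have hdF (v : ℝ × ℝ) (p : ℝ × ℝ) : fderiv ℝ (fun p : ℝ × ℝ => F (bpt p t)) p v =
      fderiv ℝ F (bpt p t) (![v.1, v.2, 0]) := by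
    have h1 : HasFDerivAt (fun p : ℝ × ℝ => bpt p t)
        (ContinuousLinearMap.pi ![ContinuousLinearMap.fst ℝ ℝ ℝ, ContinuousLinearMap.snd ℝ ℝ ℝ, 0])
        p := by
      refine hasFDerivAt_pi.2 fun i => ?_
      fin_cases i
      · exact hasFDerivAt_fst
      · exact hasFDerivAt_snd
      · exact hasFDerivAt_const _ _
    have h2 := ((hF.differentiable one_ne_zero (bpt p t)).hasFDerivAt.comp p h1).fderiv
    erw [h2]
    simp only [ContinuousLinearMap.comp_apply]
    congr 1
    ext i
    fin_cases i <;> simp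
  have hprod (v : ℝ × ℝ) (p : ℝ × ℝ) : fderiv ℝ (fun p : ℝ × ℝ => F (bpt p t) * e p) p v =
      fderiv ℝ F (bpt p t) (![v.1, v.2, 0]) * e p -
        Complex.I * ((n.1 : ℝ) * v.1 + (n.2 : ℝ) * v.2 : ℝ) * (F (bpt p t) * e p) := by
    rw [fderiv_fun_mul (hFb.differentiable one_ne_zero p) (hec.differentiable one_ne_zero p)]
    simp only [_root_.add_apply, _root_.smul_apply, hded, hdF, smul_eq_mul]
    ring
  have key := integral_sq2_fderiv (hFb.mul hec)
    (fun a b => by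
      simp only [(hp.bpt_right a b t).1, he]
      rw [← exp_fourier_add_two_pi n.1
        (-Complex.I * (((n.1 : ℝ) * a + (n.2 : ℝ) * b : ℝ) : ℂ))]
      congr 2
      push_cast
      ring)
    (fun a b => by
      simp only [(hp.bpt_right a b t).2, he]
      rw [← exp_fourier_add_two_pi n.2
        (-Complex.I * (((n.1 : ℝ) * a + (n.2 : ℝ) * b : ℝ) : ℂ))]
      congr 2
      push_cast
      ring)
  simp only [hprod] at key
  have hcont (w : R3) : Continuous fun p : ℝ × ℝ => fderiv ℝ F (bpt p t) w * e p :=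
    (((hF.continuous_fderiv one_ne_zero).comp (continuous_bpt_left t)).clm_apply
      continuous_const).mul hec.continuous
  have hFe (c : ℂ) : Continuous fun p => c * (F (bpt p t) * e p) :=
    continuous_const.mul (hFb.continuous.mul hec.continuous)
  rw [integral_sub (Continuous.integrableOn_sq2 (hcont _)) (Continuous.integrableOn_sq2 (hFe _)),
    integral_sub (Continuous.integrableOn_sq2 (hcont _)) (Continuous.integrableOn_sq2 (hFe _)),
    integral_const_mul,
    integral_const_mul] at key
  have v0 : (![1, 0, 0] : R3) = Pi.single 0 1 := by ext i; fin_cases i <;> simp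
  have v1 : (![0, 1, 0] : R3) = Pi.single 1 1 := by ext i; fin_cases i <;> simp
  simp only [v0, v1, sub_eq_zero] at key
  have hs (G : ℝ × ℝ → ℂ) :
      sqCoeff n G = (1 / (4 * (π : ℂ) ^ 2)) * ∫ p in sq2, G p * e p := rfl
  constructor
  · rw [hs, hs]
    refine (congrArg _ key.1).trans ?_
    push_cast
    ring
  · rw [hs, hs]
    refine (congrArg _ key.2).trans ?_
    push_cast
    ring

theorem hasDerivAt_sqCoeff {F : R3 → ℂ} (hF : ContDiff ℝ 1 F) (n : ℤ × ℤ) (t : ℝ) :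
    HasDerivAt (fun s => sqCoeff n fun p => F (bpt p s))
      (sqCoeff n fun p => pdC 2 F (bpt p t)) t := by
  refine HasDerivAt.const_mul _ ?_
  set e : ℝ × ℝ → ℂ := fun p =>
    Complex.exp (-Complex.I * (((n.1 : ℝ) * p.1 + (n.2 : ℝ) * p.2 : ℝ) : ℂ)) with he
  have hec : Continuous e := by fun_prop
  have hpd : Continuous (pdC 2 F) :=
    (hF.continuous_fderiv one_ne_zero).clm_apply continuous_const
  have hj : Continuous fun q : (ℝ × ℝ) × ℝ => pdC 2 F (bpt q.1 q.2) * e q.1 :=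
    (hpd.comp continuous_bpt).mul (hec.comp continuous_fst)
  obtain ⟨C, hC⟩ := ((isCompact_Icc (a := ((0 : ℝ), (0 : ℝ))) (b := (2 * π, 2 * π))).prod
    (isCompact_closedBall t 1)).exists_bound_of_continuousOn hj.continuousOn
  have hder (p : ℝ × ℝ) (s : ℝ) :
      HasDerivAt (fun s => F (bpt p s) * e p) (pdC 2 F (bpt p s) * e p) s := by
    refine HasDerivAt.mul_const ?_ _
    have h1 : HasDerivAt (fun s => bpt p s) (Pi.single 2 1) s := by
      refine hasDerivAt_pi.2 fun i => ?_
      fin_cases i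
      · simpa [bpt] using hasDerivAt_const s p.1
      · simpa [bpt] using hasDerivAt_const s p.2
      · simpa [bpt] using hasDerivAt_id' s
    exact (hF.differentiable one_ne_zero (bpt p s)).hasFDerivAt.comp_hasDerivAt s h1
  refine (hasDerivAt_integral_of_dominated_loc_of_deriv_le
    (F := fun s p => F (bpt p s) * e p) (F' := fun s p => pdC 2 F (bpt p s) * e p)
    (bound := fun _ => C) (Metric.closedBall_mem_nhds t one_pos) ?_ ?_ ?_ ?_ ?_ ?_).2
  · exact Filter.Eventually.of_forall fun s =>
      ((hF.continuous.comp (continuous_bpt_left s)).mul hec).aestronglyMeasurable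
  · exact Continuous.integrableOn_sq2 ((hF.continuous.comp (continuous_bpt_left t)).mul hec)
  · exact ((hpd.comp (continuous_bpt_left t)).mul hec).aestronglyMeasurable
  · refine (ae_restrict_mem measurableSet_sq2).mono fun p hp s hs => hC (p, s) ⟨?_, hs⟩
    exact ⟨⟨hp.1.1.le, hp.2.1.le⟩, ⟨hp.1.2.le, hp.2.2.le⟩⟩
  · exact Continuous.integrableOn_sq2 continuous_const
  · exact Filter.Eventually.of_forall fun p s _ => hder p s

end FourierDerivatives

section TrigonometricPolynomials

open ComplexConjugate

theorem sqCoeff_const_mul (n : ℤ × ℤ) (c : ℂ) (F : ℝ × ℝ → ℂ) :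
    sqCoeff n (fun p => c * F p) = c * sqCoeff n F := by
  simp only [sqCoeff, mul_assoc, integral_const_mul]
  ring

theorem integrableOn_sq2_mul_exp {F : ℝ × ℝ → ℂ} (hF : Continuous F) (n : ℤ × ℤ) :
    IntegrableOn (fun p => F p * Complex.exp (-Complex.I *
      (((n.1 : ℝ) * p.1 + (n.2 : ℝ) * p.2 : ℝ) : ℂ))) sq2 :=
  Continuous.integrableOn_sq2 (by fun_prop)

theorem sqCoeff_add (n : ℤ × ℤ) {F G : ℝ × ℝ → ℂ} (hF : Continuous F) (hG : Continuous G) :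
    sqCoeff n (fun p => F p + G p) = sqCoeff n F + sqCoeff n G := by
  simp only [sqCoeff, add_mul, ← mul_add]
  rw [integral_add (integrableOn_sq2_mul_exp hF n) (integrableOn_sq2_mul_exp hG n)]

theorem sqCoeff_sub (n : ℤ × ℤ) {F G : ℝ × ℝ → ℂ} (hF : Continuous F) (hG : Continuous G) :
    sqCoeff n (fun p => F p - G p) = sqCoeff n F - sqCoeff n G := by
  simp only [sqCoeff, sub_mul, ← mul_sub]
  rw [integral_sub (integrableOn_sq2_mul_exp hF n) (integrableOn_sq2_mul_exp hG n)]

theorem sqCoeff_sum {ι : Type*} (n : ℤ × ℤ) (s : Finset ι) {F : ι → ℝ × ℝ → ℂ}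
    (hF : ∀ i, Continuous (F i)) :
    sqCoeff n (fun p => ∑ i ∈ s, F i p) = ∑ i ∈ s, sqCoeff n (F i) := by
  simp only [sqCoeff, Finset.sum_mul, ← Finset.mul_sum]
  rw [integral_finsetSum _ fun i _ => integrableOn_sq2_mul_exp (hF i) n]

/-- The exponential `exp(i n·p)`. -/
def expMode (n : ℤ × ℤ) (p : ℝ × ℝ) : ℂ :=
  Complex.exp (Complex.I * (((n.1 : ℝ) * p.1 + (n.2 : ℝ) * p.2 : ℝ) : ℂ))

theorem continuous_expMode (n : ℤ × ℤ) : Continuous (expMode n) := by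
  unfold expMode
  fun_prop

theorem sqCoeff_expMode (m n : ℤ × ℤ) : sqCoeff m (expMode n) = if m = n then 1 else 0 := by
  have h1 : (fun y => expMode n (torusRep y)) = UnitAddTorus.mFourier ![n.1, n.2] := by
    funext y
    have := mFourier_eq_exp_torusRep (-![n.1, n.2]) y
    rw [neg_neg] at this
    rw [this, expMode]
    congr 1
    simp
    ring
  have h2 := mFourierCoeff_comp_torusRep (expMode n) ![m.1, m.2]
  rw [h1, ← UnitAddTorus.mFourierCoeff_toLp, ← UnitAddTorus.mFourierBasis_repr,
    HilbertBasis.repr_apply_apply, UnitAddTorus.coe_mFourierBasis] at h2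
  have h3 := orthonormal_iff_ite.1 (UnitAddTorus.orthonormal_mFourier (d := Fin 2))
    ![m.1, m.2] ![n.1, n.2]
  have h4 : (![m.1, m.2] : Fin 2 → ℤ) = ![n.1, n.2] ↔ m = n := by
    simp [Prod.ext_iff, funext_iff, Fin.forall_fin_two]
  simp only [h4] at h3
  exact h2.symm.trans h3

/-- A nonnegative continuous function on an open set with nonpositive integral vanishes. -/
theorem eqOn_zero_of_setIntegral_nonpos {X : Type*} [TopologicalSpace X] [MeasurableSpace X]
    [OpensMeasurableSpace X] {μ : Measure X} [μ.IsOpenPosMeasure] {U : Set X} (hU : IsOpen U)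
    {f : X → ℝ} (hc : ContinuousOn f U) (hi : IntegrableOn f U μ) (h0 : ∀ x ∈ U, 0 ≤ f x)
    (hle : ∫ x in U, f x ∂μ ≤ 0) : ∀ x ∈ U, f x = 0 := by
  have hae : 0 ≤ᵐ[μ.restrict U] f := (ae_restrict_mem hU.measurableSet).mono h0
  have hz := (setIntegral_eq_zero_iff_of_nonneg_ae hae hi).1
    (hle.antisymm (setIntegral_nonneg hU.measurableSet h0))
  exact Measure.eqOn_open_of_ae_eq hz hU hc continuousOn_const

theorem eq_zero_on_sq2_of_sqCoeff_eq_zero {F : ℝ × ℝ → ℂ} (hF : Continuous F)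
    (h0 : ∀ n, sqCoeff n F = 0) : ∀ p ∈ sq2, F p = 0 := by
  have key := hasSum_sqCoeff_mul_conj hF hF
  simp only [h0, zero_mul, Complex.mul_conj, integral_complex_ofReal] at key
  have h1 := hasSum_zero.unique key
  have hpi : (1 / (4 * (π : ℂ) ^ 2)) ≠ 0 := by
    simp [Real.pi_ne_zero]
  have h2 : ∫ p in sq2, Complex.normSq (F p) = 0 := by
    have := (mul_eq_zero.1 h1.symm).resolve_left hpi
    exact_mod_cast this
  have hcont : Continuous fun p => Complex.normSq (F p) := Complex.continuous_normSq.comp hF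
  intro p hp
  exact Complex.normSq_eq_zero.1 (eqOn_zero_of_setIntegral_nonpos (isOpen_Ioo.prod isOpen_Ioo)
    hcont.continuousOn hcont.integrableOn_sq2 (fun _ _ => Complex.normSq_nonneg _) h2.le p hp)

/-- A continuous function on the square with finitely many nonzero Fourier coefficients
vanishes as soon as it vanishes on a nonempty open set. -/
theorem eq_zero_on_sq2_of_finite_of_open {F : ℝ × ℝ → ℂ} (hF : Continuous F) (S : Finset (ℤ × ℤ))
    (hS : ∀ n, n ∉ S → sqCoeff n F = 0) {U : Set (ℝ × ℝ)} (hU : IsOpen U) (hne : U.Nonempty)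
    (hsub : U ⊆ sq2) (hz : ∀ p ∈ U, F p = 0) : ∀ p ∈ sq2, F p = 0 := by
  have hm (n : ℤ × ℤ) : Continuous fun p => sqCoeff n F * expMode n p :=
    continuous_const.mul (continuous_expMode n)
  have hP : Continuous fun p => ∑ n ∈ S, sqCoeff n F * expMode n p :=
    continuous_finsetSum _ fun n _ => hm n
  have hFP : ∀ p ∈ sq2, F p = ∑ n ∈ S, sqCoeff n F * expMode n p := by
    intro p hp
    refine sub_eq_zero.1 (eq_zero_on_sq2_of_sqCoeff_eq_zero (hF.sub hP) (fun n => ?_) p hp)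
    refine (sqCoeff_sub n hF hP).trans ?_
    rw [sqCoeff_sum n S hm]
    simp only [sqCoeff_const_mul, sqCoeff_expMode, mul_ite, mul_one, mul_zero, Finset.sum_ite_eq]
    split_ifs with h
    · exact sub_self _
    · rw [hS n h, sub_zero]
  obtain ⟨q, hq⟩ := hne
  intro p hp
  rw [hFP p hp]
  set φ : ℂ → ℂ := fun z => ∑ n ∈ S, sqCoeff n F * Complex.exp (Complex.I *
    ((n.1 : ℂ) * (q.1 + z * (p.1 - q.1)) + (n.2 : ℂ) * (q.2 + z * (p.2 - q.2)))) with hφ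
  have hφd : Differentiable ℂ φ := by
    rw [hφ]
    fun_prop
  have hφa : AnalyticOnNhd ℂ φ Set.univ := fun z _ => hφd.analyticAt z
  have hφr (t : ℝ) : φ t = ∑ n ∈ S, sqCoeff n F * expMode n (q + t • (p - q)) := by
    simp only [hφ, expMode]
    refine Finset.sum_congr rfl fun n _ => ?_
    congr 3
    simp
  have hline : Continuous fun t : ℝ => q + t • (p - q) := by fun_prop
  have hnear : ∀ᶠ t : ℝ in nhds 0, φ t = 0 := by
    have : ∀ᶠ t : ℝ in nhds 0, q + t • (p - q) ∈ U :=
      hline.continuousAt.eventually_mem (hU.mem_nhds (by simpa using hq))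
    filter_upwards [this] with t ht
    rw [hφr, ← hFP _ (hsub ht), hz _ ht]
  have hfreq : ∃ᶠ z : ℂ in nhdsWithin 0 {0}ᶜ, φ z = 0 := by
    have h1 : Filter.Tendsto (fun t : ℝ => (t : ℂ)) (nhdsWithin 0 {0}ᶜ) (nhdsWithin 0 {0}ᶜ) := by
      refine tendsto_nhdsWithin_of_tendsto_nhds_of_eventually_within _
        ((Complex.continuous_ofReal.tendsto' 0 0 (by simp)).mono_left nhdsWithin_le_nhds) ?_
      filter_upwards [self_mem_nhdsWithin] with t ht
      simpa using ht
    exact h1.frequently (hnear.filter_mono nhdsWithin_le_nhds).frequently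
  have h1 : φ = fun _ => 0 := hφa.eq_of_frequently_eq (fun z _ => analyticAt_const) hfreq
  have h2 := hφr 1
  simp only [one_smul, add_sub_cancel] at h2
  rw [← h2, h1]

end TrigonometricPolynomials

section VectorCalculus

open ComplexConjugate

theorem pdC_add {f g : R3 → ℂ} {x : R3} (hf : DifferentiableAt ℝ f x)
    (hg : DifferentiableAt ℝ g x) (i : Fin 3) :
    pdC i (fun y => f y + g y) x = pdC i f x + pdC i g x := by
  simp [pdC, fderiv_fun_add hf hg]

theorem pdC_sub {f g : R3 → ℂ} {x : R3} (hf : DifferentiableAt ℝ f x)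
    (hg : DifferentiableAt ℝ g x) (i : Fin 3) :
    pdC i (fun y => f y - g y) x = pdC i f x - pdC i g x := by
  simp [pdC, fderiv_fun_sub hf hg]

theorem pdC_mul {f g : R3 → ℂ} {x : R3} (hf : DifferentiableAt ℝ f x)
    (hg : DifferentiableAt ℝ g x) (i : Fin 3) :
    pdC i (fun y => f y * g y) x = pdC i f x * g x + f x * pdC i g x := by
  simp [pdC, fderiv_fun_mul hf hg]
  ring

theorem pdC_const (c : ℂ) (i : Fin 3) (x : R3) : pdC i (fun _ => c) x = 0 := by
  simp [pdC]

theorem pdC_const_mul {f : R3 → ℂ} {x : R3} (hf : DifferentiableAt ℝ f x) (c : ℂ) (i : Fin 3) :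
    pdC i (fun y => c * f y) x = c * pdC i f x := by
  rw [pdC_mul (differentiableAt_const c) hf, pdC_const, zero_mul, zero_add]

theorem DifferentiableAt.conjC {f : R3 → ℂ} {x : R3} (hf : DifferentiableAt ℝ f x) :
    DifferentiableAt ℝ (fun y => conj (f y)) x :=
  Complex.conjCLE.differentiableAt.comp x hf

theorem pdC_conj {f : R3 → ℂ} {x : R3} (hf : DifferentiableAt ℝ f x) (i : Fin 3) :
    pdC i (fun y => conj (f y)) x = conj (pdC i f x) := by
  have := (Complex.conjCLE.toContinuousLinearMap.hasFDerivAt.comp x hf.hasFDerivAt).fderiv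
  exact congrArg (fun l : R3 →L[ℝ] ℂ => l (Pi.single i 1)) this

theorem DifferentiableAt.ofRealC {f : R3 → ℝ} {x : R3} (hf : DifferentiableAt ℝ f x) :
    DifferentiableAt ℝ (fun y => (f y : ℂ)) x :=
  Complex.ofRealCLM.differentiableAt.comp x hf

theorem pdC_ofReal {f : R3 → ℝ} {x : R3} (hf : DifferentiableAt ℝ f x) (i : Fin 3) :
    pdC i (fun y => (f y : ℂ)) x = (pdR i f x : ℂ) := by
  have := (Complex.ofRealCLM.hasFDerivAt.comp x hf.hasFDerivAt).fderiv
  exact congrArg (fun l : R3 →L[ℝ] ℂ => l (Pi.single i 1)) this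

theorem DifferentiableAt.comp_apply {F : R3 → C3} {x : R3} (hF : DifferentiableAt ℝ F x)
    (j : Fin 3) : DifferentiableAt ℝ (fun y => F y j) x :=
  differentiableAt_pi.1 hF j

/-- Divergence of `F × conj G`; the quasi-momentum cancels. -/
theorem divFld_cross_conj (α : R3) {F G : R3 → C3} {x : R3} (hF : DifferentiableAt ℝ F x)
    (hG : DifferentiableAt ℝ G x) :
    divFld (fun y => crossC (F y) (conjV (G y))) x =
      dotc (curlA α F x) (G x) - dotc (F x) (curlA α G x) := by
  have h (i j l : Fin 3) : pdC i (fun y => F y j * conj (G y l)) x =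
      pdC i (fun y => F y j) x * conj (G x l) + F x j * conj (pdC i (fun y => G y l) x) := by
    rw [pdC_mul (hF.comp_apply j) (hG.comp_apply l).conjC, pdC_conj (hG.comp_apply l)]
  have h' (i j l m n : Fin 3) :
      pdC i (fun y => F y j * conj (G y l) - F y m * conj (G y n)) x = _ :=
    pdC_sub ((hF.comp_apply j).fun_mul (hG.comp_apply l).conjC)
      ((hF.comp_apply m).fun_mul (hG.comp_apply n).conjC) i
  simp only [divFld, crossC, conjV, Fin.sum_univ_three, Matrix.cons_val_zero, Matrix.cons_val_one,
    Matrix.cons_val, h', h, dotc, curlA, curlF, Pi.add_apply, Pi.smul_apply, smul_eq_mul,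
    realToC3, map_add, map_sub, map_mul, Complex.conj_I, Complex.conj_ofReal]
  ring

theorem divFld_add {F G : R3 → C3} {x : R3} (hF : DifferentiableAt ℝ F x)
    (hG : DifferentiableAt ℝ G x) :
    divFld (fun y => F y + G y) x = divFld F x + divFld G x := by
  simp only [divFld, Pi.add_apply, pdC_add (hF.comp_apply _) (hG.comp_apply _),
    Finset.sum_add_distrib]

theorem divFld_smul {g : R3 → ℂ} {F : R3 → C3} {x : R3} (hg : DifferentiableAt ℝ g x)
    (hF : DifferentiableAt ℝ F x) :
    divFld (fun y => g y • F y) x = g x * divFld F x + ∑ i, pdC i g x * F x i := by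
  simp only [divFld, Pi.smul_apply, smul_eq_mul, pdC_mul hg (hF.comp_apply _),
    Finset.sum_add_distrib, Finset.mul_sum]
  ring

theorem divFld_smul_e3 {g : R3 → ℂ} {x : R3} (hg : DifferentiableAt ℝ g x) :
    divFld (fun y => g y • e3) x = pdC 2 g x := by
  rw [divFld_smul hg (differentiableAt_const e3)]
  simp [divFld, pdC_const, Fin.sum_univ_three, e3]

theorem DifferentiableAt.conjV {G : R3 → C3} {x : R3} (hG : DifferentiableAt ℝ G x) :
    DifferentiableAt ℝ (fun y => conjV (G y)) x :=
  differentiableAt_pi.2 fun j => (hG.comp_apply j).conjC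

theorem divFld_smul_conj (α : R3) {f : R3 → ℂ} {G : R3 → C3} {x : R3}
    (hf : DifferentiableAt ℝ f x) (hG : DifferentiableAt ℝ G x) :
    divFld (fun y => f y • conjV (G y)) x =
      ∑ i, pdA α i f x * conj (G x i) + f x * conj (divA α G x) := by
  rw [divFld_smul hf hG.conjV]
  simp only [divFld, conjV, pdC_conj (hG.comp_apply _), divA, pdA, Fin.sum_univ_three, map_add,
    map_mul, Complex.conj_I, Complex.conj_ofReal]
  ring

theorem nsq_eq_dotc (v : C3) : (nsq v : ℂ) = dotc v v := by
  simp [nsq, dotc, Complex.mul_conj]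

theorem DifferentiableAt.dotc {F G : R3 → C3} {x : R3} (hF : DifferentiableAt ℝ F x)
    (hG : DifferentiableAt ℝ G x) : DifferentiableAt ℝ (fun y => dotc (F y) (G y)) x :=
  DifferentiableAt.fun_sum fun j _ => (hF.comp_apply j).fun_mul (hG.comp_apply j).conjC

theorem pdC_dotc_self {F : R3 → C3} {x : R3} (hF : DifferentiableAt ℝ F x) (i : Fin 3) :
    pdC i (fun y => dotc (F y) (F y)) x = dotc (pdV i F x) (F x) + dotc (F x) (pdV i F x) := by
  have h (j : Fin 3) : pdC i (fun y => F y j * conj (F y j)) x = _ :=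
    pdC_mul (hF.comp_apply j) (hF.comp_apply j).conjC i
  have hd (j : Fin 3) := (hF.comp_apply j).fun_mul (hF.comp_apply j).conjC
  simp only [_root_.dotc, Fin.sum_univ_three]
  rw [pdC_add ((hd 0).fun_add (hd 1)) (hd 2), pdC_add (hd 0) (hd 1)]
  simp only [h, pdC_conj (hF.comp_apply _), pdV]
  ring

theorem dotc_conj (u v : C3) : conj (dotc u v) = dotc v u := by
  simp [dotc, mul_comm]

theorem contDiff_pdC {f : R3 → ℂ} (hf : ContDiff ℝ 2 f) (i : Fin 3) : ContDiff ℝ 1 (pdC i f) :=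
  (hf.fderiv_right (m := 1) (by norm_num)).clm_apply contDiff_const

theorem continuous_pdC {f : R3 → ℂ} (hf : ContDiff ℝ 1 f) (i : Fin 3) : Continuous (pdC i f) :=
  (hf.continuous_fderiv (by norm_num)).clm_apply continuous_const

theorem continuous_pdR {f : R3 → ℝ} (hf : ContDiff ℝ 1 f) (i : Fin 3) : Continuous (pdR i f) :=
  (hf.continuous_fderiv (by norm_num)).clm_apply continuous_const

theorem ContDiff.comp_apply {n : WithTop ℕ∞} {F : R3 → C3} (hF : ContDiff ℝ n F) (j : Fin 3) :
    ContDiff ℝ n (fun y => F y j) :=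
  contDiff_pi.1 hF j

theorem contDiff_pdV {F : R3 → C3} (hF : ContDiff ℝ 2 F) (i : Fin 3) : ContDiff ℝ 1 (pdV i F) :=
  contDiff_pi.2 fun j => contDiff_pdC (hF.comp_apply j) i

theorem contDiff_curlA (α : R3) {F : R3 → C3} (hF : ContDiff ℝ 2 F) :
    ContDiff ℝ 1 (curlA α F) := by
  have h (i j : Fin 3) := contDiff_pdC (hF.comp_apply j) i
  have h' (j : Fin 3) : ContDiff ℝ 1 fun y => F y j := (hF.comp_apply j).of_le (by norm_num)
  refine contDiff_pi.2 fun j => ?_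
  fin_cases j <;>
  · simp only [curlA, curlF, crossC, realToC3, Pi.add_apply, Pi.smul_apply, smul_eq_mul,
      Fin.zero_eta, Fin.mk_one, Fin.reduceFinMk, Matrix.cons_val_zero, Matrix.cons_val_one,
      Matrix.cons_val]
    fun_prop

theorem pdC_comm {f : R3 → ℂ} (hf : ContDiff ℝ 2 f) (i j : Fin 3) (x : R3) :
    pdC i (pdC j f) x = pdC j (pdC i f) x := by
  have hsymm : IsSymmSndFDerivAt ℝ f x :=
    hf.contDiffAt.isSymmSndFDerivAt (by simp)
  have hd : DifferentiableAt ℝ (fderiv ℝ f) x :=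
    ((hf.fderiv_right (m := 1) (by norm_num)).differentiable (by norm_num)) x
  have h (i j : Fin 3) : pdC i (pdC j f) x =
      fderiv ℝ (fderiv ℝ f) x (Pi.single i 1) (Pi.single j 1) := by
    unfold pdC
    rw [fderiv_clm_apply hd (differentiableAt_const _)]
    simp
  rw [h, h]
  exact hsymm.eq _ _

theorem pdV_curlA (α : R3) {F : R3 → C3} (hF : ContDiff ℝ 2 F) (i : Fin 3) (x : R3) :
    curlA α (pdV i F) x = pdV i (curlA α F) x := by
  have hd (j l : Fin 3) : DifferentiableAt ℝ (pdC l fun y => F y j) x :=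
    (contDiff_pdC (hF.comp_apply j) l).differentiable (by norm_num) x
  have hd' (j : Fin 3) : DifferentiableAt ℝ (fun y => F y j) x :=
    (hF.comp_apply j).differentiable (by norm_num) x
  have key (j l m n : Fin 3) (a b : ℂ) :
      pdC i (fun y => pdC j (fun z => F z l) y - pdC m (fun z => F z n) y +
        Complex.I * (a * F y l - b * F y n)) x =
      pdC j (pdC i fun z => F z l) x - pdC m (pdC i fun z => F z n) x +
        Complex.I * (a * pdC i (fun z => F z l) x - b * pdC i (fun z => F z n) x) := by
    have hm (c : ℂ) (j : Fin 3) : DifferentiableAt ℝ (fun y => c * F y j) x :=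
      (differentiableAt_const c).fun_mul (hd' j)
    have hs : DifferentiableAt ℝ (fun y => a * F y l - b * F y n) x := (hm a l).fun_sub (hm b n)
    rw [pdC_add ((hd l j).fun_sub (hd n m)) ((differentiableAt_const _).fun_mul hs),
      pdC_sub (hd l j) (hd n m), pdC_const_mul hs, pdC_sub (hm a l) (hm b n),
      pdC_const_mul (hd' l), pdC_const_mul (hd' n), pdC_comm (hF.comp_apply l) i j,
      pdC_comm (hF.comp_apply n) i m]
  ext c
  fin_cases c
  · exact (key 1 2 2 1 _ _).symm
  · exact (key 2 0 0 2 _ _).symm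
  · exact (key 0 1 1 0 _ _).symm

theorem divA_pdV (α : R3) {F : R3 → C3} (hF : ContDiff ℝ 2 F) (i : Fin 3) (x : R3) :
    divA α (pdV i F) x = pdC i (divA α F) x := by
  have hd (j l : Fin 3) : DifferentiableAt ℝ (pdC l fun y => F y j) x :=
    (contDiff_pdC (hF.comp_apply j) l).differentiable (by norm_num) x
  have hd' (j : Fin 3) : DifferentiableAt ℝ (fun y => F y j) x :=
    (hF.comp_apply j).differentiable (by norm_num) x
  have hm (c : ℂ) (j : Fin 3) : DifferentiableAt ℝ (fun y => c * F y j) x :=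
    (differentiableAt_const c).fun_mul (hd' j)
  have e : divA α F = fun y => pdC 0 (fun z => F z 0) y + pdC 1 (fun z => F z 1) y +
      pdC 2 (fun z => F z 2) y + Complex.I * ((α 0 : ℂ) * F y 0 + (α 1 : ℂ) * F y 1 +
        (α 2 : ℂ) * F y 2) := by
    funext y
    simp [divA, divFld, Fin.sum_univ_three]
  rw [e, pdC_add (((hd 0 0).fun_add (hd 1 1)).fun_add (hd 2 2))
      ((differentiableAt_const _).fun_mul (((hm _ 0).fun_add (hm _ 1)).fun_add (hm _ 2))),
    pdC_add ((hd 0 0).fun_add (hd 1 1)) (hd 2 2), pdC_add (hd 0 0) (hd 1 1),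
    pdC_const_mul (((hm _ 0).fun_add (hm _ 1)).fun_add (hm _ 2)),
    pdC_add ((hm _ 0).fun_add (hm _ 1)) (hm _ 2), pdC_add (hm _ 0) (hm _ 1),
    pdC_const_mul (hd' 0), pdC_const_mul (hd' 1), pdC_const_mul (hd' 2),
    pdC_comm (hF.comp_apply 0) i, pdC_comm (hF.comp_apply 1) i, pdC_comm (hF.comp_apply 2) i]
  simp only [divA, divFld, Fin.sum_univ_three, pdV]

theorem continuous_divA (α : R3) {F : R3 → C3} (hF : ContDiff ℝ 1 F) : Continuous (divA α F) := by
  have h (i j : Fin 3) := continuous_pdC (hF.comp_apply j) i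
  have h' (j : Fin 3) : Continuous fun y => F y j := (hF.comp_apply j).continuous
  unfold divA divFld
  simp only [Fin.sum_univ_three]
  fun_prop

theorem Biperiodic.pdC {f : R3 → ℂ} (hf : Biperiodic f) (i : Fin 3) : Biperiodic (pdC i f) := by
  have key (v : R3) (hv : ∀ x, f (x + v) = f x) (x : R3) :
      _root_.pdC i f (x + v) = _root_.pdC i f x := by
    have : (fun y => f (y + v)) = f := funext hv
    unfold _root_.pdC
    rw [← fderiv_comp_add_right, this]
  exact fun x => ⟨key _ (fun y => (hf y).1) x, key _ (fun y => (hf y).2) x⟩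

theorem Biperiodic.comp_apply {F : R3 → C3} (hF : Biperiodic F) (j : Fin 3) :
    Biperiodic fun y => F y j :=
  fun x => ⟨congrFun (hF x).1 j, congrFun (hF x).2 j⟩

theorem Biperiodic.pdV {F : R3 → C3} (hF : Biperiodic F) (i : Fin 3) : Biperiodic (pdV i F) :=
  fun x => ⟨funext fun j => ((hF.comp_apply j).pdC i x).1,
    funext fun j => ((hF.comp_apply j).pdC i x).2⟩

theorem Biperiodic.curlA (α : R3) {F : R3 → C3} (hF : Biperiodic F) : Biperiodic (curlA α F) :=
  fun x => by
    have h1 (i j : Fin 3) := ((hF.comp_apply j).pdC i x).1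
    have h2 (i j : Fin 3) := ((hF.comp_apply j).pdC i x).2
    simp only [_root_.curlA, curlF, h1, h2, (hF x).1, (hF x).2, and_self]

end VectorCalculus

section Flux

open ComplexConjugate

theorem ContDiff.conjC {n : WithTop ℕ∞} {f : R3 → ℂ} (hf : ContDiff ℝ n f) :
    ContDiff ℝ n fun y => conj (f y) :=
  Complex.conjCLE.contDiff.comp hf

theorem ContDiff.ofRealC {n : WithTop ℕ∞} {f : R3 → ℝ} (hf : ContDiff ℝ n f) :
    ContDiff ℝ n fun y => (f y : ℂ) :=
  Complex.ofRealCLM.contDiff.comp hf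

theorem ContDiff.conjV {n : WithTop ℕ∞} {F : R3 → C3} (hF : ContDiff ℝ n F) :
    ContDiff ℝ n fun y => conjV (F y) :=
  contDiff_pi.2 fun j => (hF.comp_apply j).conjC

theorem ContDiff.dotc {n : WithTop ℕ∞} {F G : R3 → C3} (hF : ContDiff ℝ n F)
    (hG : ContDiff ℝ n G) : ContDiff ℝ n fun y => dotc (F y) (G y) :=
  ContDiff.sum fun j _ => (hF.comp_apply j).mul (hG.comp_apply j).conjC

theorem ContDiff.crossC {n : WithTop ℕ∞} {F G : R3 → C3} (hF : ContDiff ℝ n F)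
    (hG : ContDiff ℝ n G) : ContDiff ℝ n fun y => crossC (F y) (G y) := by
  have h (j : Fin 3) := hF.comp_apply j
  have h' (j : Fin 3) := hG.comp_apply j
  refine contDiff_pi.2 fun j => ?_
  fin_cases j <;>
  · simp only [_root_.crossC, Fin.zero_eta, Fin.mk_one, Fin.reduceFinMk, Matrix.cons_val_zero,
      Matrix.cons_val_one, Matrix.cons_val]
    fun_prop

theorem continuous_divFld {F : R3 → C3} (hF : ContDiff ℝ 1 F) : Continuous (divFld F) :=
  continuous_finsetSum _ fun i _ => continuous_pdC (hF.comp_apply i) i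

theorem integral_divFld {h : ℝ} (hh : 0 < h) {F : R3 → C3} (hF : ContDiff ℝ 1 F)
    (hp : Biperiodic F) :
    ∫ x in Omg h, divFld F x = (∫ p in sq2, F (bpt p h) 2) - ∫ p in sq2, F (bpt p 0) 2 :=
  integral_div_cell hh (fun i y => F y i) (divFld F)
    (fun i => (hF.comp_apply i).continuous.continuousOn)
    (fun i x _ => (hF.comp_apply i).differentiable (by norm_num) x) (fun _ _ => rfl)
    (continuous_divFld hF).continuousOn (hp.comp_apply 0) (hp.comp_apply 1)

/-- The field `ε_r⁻¹ curl_α H`. -/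
def fluxS (α : R3) (a : R3 → ℝ) (H : R3 → C3) (y : R3) : C3 := (a y : ℂ) • curlA α H y

/-- The energy flux `(ε_r⁻¹ curl_α H) × conj H`. -/
def energyFlux (α : R3) (a : R3 → ℝ) (H : R3 → C3) (y : R3) : C3 :=
  crossC (fluxS α a H y) (conjV (H y))

/-- The density `x₃ (ε_r⁻¹ |curl_α H|² - k² |H|²)`. -/
def rellichDensity (k : ℝ) (α : R3) (a : R3 → ℝ) (H : R3 → C3) (y : R3) : ℂ :=
  (y 2 : ℂ) * ((a y : ℂ) * dotc (curlA α H y) (curlA α H y) - (k : ℂ) ^ 2 * dotc (H y) (H y))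

/-- The flux associated with the Rellich identity for the multiplier `x₃ ∂H/∂x₃`. -/
def rellichFlux (k : ℝ) (α : R3) (a : R3 → ℝ) (H : R3 → C3) (y : R3) : C3 :=
  (2 * (y 2 : ℂ)) • crossC (fluxS α a H y) (conjV (pdV 2 H y)) + rellichDensity k α a H y • e3 +
    energyFlux α a H y + (-2 * ((a y : ℂ) * H y 2)) • conjV (pdV 2 H y)

/-- Minus the real part of the divergence of the Rellich flux. -/
def rellichIntegrand (α : R3) (a : R3 → ℝ) (H : R3 → C3) (x : R3) : ℝ :=
  -(x 2) * pdR 2 a x * nsq (curlA α H x) + 2 * a x * nsq (pdV 2 H x) +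
    2 * (∑ i, (pdR i a x : ℂ) * (H x 2 * conj (pdV 2 H x i))).re

variable {h k : ℝ} {α : R3} {a : R3 → ℝ} {H : R3 → C3}

theorem contDiff_fluxS (ha : ContDiff ℝ 1 a) (hH : ContDiff ℝ 2 H) :
    ContDiff ℝ 1 (fluxS α a H) :=
  ha.ofRealC.smul (contDiff_curlA α hH)

theorem contDiff_energyFlux (ha : ContDiff ℝ 1 a) (hH : ContDiff ℝ 2 H) :
    ContDiff ℝ 1 (energyFlux α a H) :=
  (contDiff_fluxS ha hH).crossC (hH.of_le (by norm_num)).conjV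

theorem contDiff_coord : ContDiff ℝ 1 fun y : R3 => (y 2 : ℂ) :=
  ContDiff.ofRealC (contDiff_apply ℝ ℝ 2)

theorem contDiff_rellichDensity (ha : ContDiff ℝ 1 a) (hH : ContDiff ℝ 2 H) :
    ContDiff ℝ 1 (rellichDensity k α a H) := by
  have hC := contDiff_curlA α hH
  have hH1 : ContDiff ℝ 1 H := hH.of_le (by norm_num)
  exact contDiff_coord.mul ((ha.ofRealC.mul (hC.dotc hC)).sub (contDiff_const.mul (hH1.dotc hH1)))

theorem contDiff_rellichFlux (ha : ContDiff ℝ 1 a) (hH : ContDiff ℝ 2 H) :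
    ContDiff ℝ 1 (rellichFlux k α a H) := by
  have hV := contDiff_pdV hH 2
  have hH1 : ContDiff ℝ 1 H := hH.of_le (by norm_num)
  exact ((((contDiff_const.mul contDiff_coord).smul ((contDiff_fluxS ha hH).crossC hV.conjV)).add
    ((contDiff_rellichDensity ha hH).smul contDiff_const)).add (contDiff_energyFlux ha hH)).add
    ((contDiff_const.mul (ha.ofRealC.mul (hH1.comp_apply 2))).smul hV.conjV)

theorem coord_add_lateral (y : R3) (i : Fin 3) (hi : i ≠ 2) :
    (y + (2 * π) • (Pi.single i 1 : R3)) 2 = y 2 := by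
  simp [hi.symm]

theorem Biperiodic.fluxS (ha : Biperiodic a) (hH : Biperiodic H) : Biperiodic (fluxS α a H) :=
  fun x => by
    simp only [_root_.fluxS, (ha x).1, (ha x).2, (hH.curlA α x).1, (hH.curlA α x).2, and_self]

theorem Biperiodic.energyFlux (ha : Biperiodic a) (hH : Biperiodic H) :
    Biperiodic (energyFlux α a H) :=
  fun x => by
    have hS := Biperiodic.fluxS (α := α) ha hH x
    simp only [_root_.energyFlux, hS.1, hS.2, (hH x).1, (hH x).2, and_self]

theorem Biperiodic.rellichFlux (ha : Biperiodic a) (hH : Biperiodic H) :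
    Biperiodic (rellichFlux k α a H) :=
  fun x => by
    have hS := Biperiodic.fluxS (α := α) ha hH x
    have hE := Biperiodic.energyFlux (α := α) ha hH x
    have hV := hH.pdV 2 x
    have hC := hH.curlA α x
    have c0 := coord_add_lateral x 0 (by decide)
    have c1 := coord_add_lateral x 1 (by decide)
    simp only [_root_.rellichFlux, rellichDensity, hS.1, hS.2, hE.1, hE.2, (hH x).1, (hH x).2,
      (ha x).1, (ha x).2, hV.1, hV.2, hC.1, hC.2, c0, c1, and_self]

theorem divFld_energyFlux (ha : ContDiff ℝ 1 a) (hH : ContDiff ℝ 2 H) {x : R3}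
    (hM : curlA α (fluxS α a H) x = (k ^ 2 : ℂ) • H x) :
    divFld (energyFlux α a H) x =
      (k : ℂ) ^ 2 * dotc (H x) (H x) - (a x : ℂ) * dotc (curlA α H x) (curlA α H x) := by
  have hS : DifferentiableAt ℝ (fluxS α a H) x :=
    (contDiff_fluxS ha hH).differentiable (by norm_num) x
  have := divFld_cross_conj α hS (hH.differentiable (by norm_num) x)
  refine this.trans ?_
  rw [hM]
  simp only [dotc, fluxS, Fin.sum_univ_three, Pi.smul_apply, smul_eq_mul]
  ring

theorem pdC_coord (i : Fin 3) (x : R3) :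
    pdC i (fun y : R3 => (y 2 : ℂ)) x = if i = 2 then 1 else 0 := by
  have hd : DifferentiableAt ℝ (fun y : R3 => y 2) x := differentiableAt_apply 2 x
  rw [pdC_ofReal hd, pdR, (hasFDerivAt_apply (𝕜 := ℝ) (2 : Fin 3) x).fderiv]
  fin_cases i <;> simp

theorem re_divFld_rellichFlux (ha : ContDiff ℝ 1 a) (hH : ContDiff ℝ 2 H) (hα : α 2 = 0) {x : R3}
    (hM : curlA α (fluxS α a H) x = (k ^ 2 : ℂ) • H x) (hV : divA α (pdV 2 H) x = 0) :
    (divFld (rellichFlux k α a H) x).re = -rellichIntegrand α a H x := by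
  have hdS : DifferentiableAt ℝ (fluxS α a H) x :=
    (contDiff_fluxS ha hH).differentiable (by norm_num) x
  have hdV : DifferentiableAt ℝ (pdV 2 H) x :=
    (contDiff_pdV hH 2).differentiable (by norm_num) x
  have hdC : DifferentiableAt ℝ (curlA α H) x :=
    (contDiff_curlA α hH).differentiable (by norm_num) x
  have hdH : DifferentiableAt ℝ H x := hH.differentiable (by norm_num) x
  have hda : DifferentiableAt ℝ a x := ha.differentiable (by norm_num) x
  have hdE : DifferentiableAt ℝ (energyFlux α a H) x :=
    (contDiff_energyFlux ha hH).differentiable (by norm_num) x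
  have hdR : DifferentiableAt ℝ (rellichDensity k α a H) x :=
    (contDiff_rellichDensity ha hH).differentiable (by norm_num) x
  have hdz : DifferentiableAt ℝ (fun y : R3 => (y 2 : ℂ)) x :=
    contDiff_coord.differentiable (by norm_num) x
  have hd2z : DifferentiableAt ℝ (fun y : R3 => 2 * (y 2 : ℂ)) x :=
    (differentiableAt_const _).fun_mul hdz
  have hdX : DifferentiableAt ℝ (fun y => crossC (fluxS α a H y) (conjV (pdV 2 H y))) x :=
    ((contDiff_fluxS ha hH).crossC (contDiff_pdV hH 2).conjV).differentiable (by norm_num) x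
  have hdaH : DifferentiableAt ℝ (fun y => (a y : ℂ) * H y 2) x :=
    hda.ofRealC.fun_mul (hdH.comp_apply 2)
  have hdf : DifferentiableAt ℝ (fun y => -2 * ((a y : ℂ) * H y 2)) x :=
    (differentiableAt_const _).fun_mul hdaH
  have hCC := hdC.dotc hdC
  have hHH := hdH.dotc hdH
  have hkHH : DifferentiableAt ℝ (fun y => (k : ℂ) ^ 2 * dotc (H y) (H y)) x :=
    (differentiableAt_const _).fun_mul hHH
  have haCC := hda.ofRealC.fun_mul hCC
  have e1 : divFld (rellichFlux k α a H) x = _ :=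
    (divFld_add (((hd2z.fun_smul hdX).fun_add (hdR.fun_smul (differentiableAt_const e3))).fun_add
      hdE) (hdf.fun_smul hdV.conjV)).trans (congrArg₂ (· + ·)
      ((divFld_add ((hd2z.fun_smul hdX).fun_add (hdR.fun_smul (differentiableAt_const e3)))
        hdE).trans (congrArg₂ (· + ·) (divFld_add (hd2z.fun_smul hdX)
          (hdR.fun_smul (differentiableAt_const e3))) rfl)) rfl)
  have e2 : pdC 2 (rellichDensity k α a H) x = (a x : ℂ) * dotc (curlA α H x) (curlA α H x) -
      (k : ℂ) ^ 2 * dotc (H x) (H x) + (x 2 : ℂ) * ((pdR 2 a x : ℂ) *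
      dotc (curlA α H x) (curlA α H x) + (a x : ℂ) * (dotc (pdV 2 (curlA α H) x) (curlA α H x) +
      dotc (curlA α H x) (pdV 2 (curlA α H) x)) - (k : ℂ) ^ 2 * (dotc (pdV 2 H x) (H x) +
      dotc (H x) (pdV 2 H x))) := by
    unfold rellichDensity
    rw [pdC_mul hdz (haCC.fun_sub hkHH), pdC_coord, pdC_sub haCC hkHH, pdC_mul hda.ofRealC hCC,
      pdC_const_mul hHH, pdC_dotc_self hdC, pdC_dotc_self hdH, pdC_ofReal hda]
    simp
  have e3' : ∀ i, pdA α i (fun y => -2 * ((a y : ℂ) * H y 2)) x =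
      -2 * ((pdR i a x : ℂ) * H x 2 + (a x : ℂ) * pdA α i (fun y => H y 2) x) := fun i => by
    rw [pdA, pdC_const_mul hdaH, pdC_mul hda.ofRealC (hdH.comp_apply 2), pdC_ofReal hda, pdA]
    ring
  have e4 : curlA α H x 0 = pdA α 1 (fun y => H y 2) x - pdV 2 H x 1 := by
    simp [curlA, curlF, crossC, realToC3, pdA, pdV, hα]
    ring
  have e5 : curlA α H x 1 = pdV 2 H x 0 - pdA α 0 (fun y => H y 2) x := by
    simp [curlA, curlF, crossC, realToC3, pdA, pdV, hα]
    ring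
  have e6 : pdA α 2 (fun y => H y 2) x = pdV 2 H x 2 := by
    simp [pdA, pdV, hα]
  have hz (i : Fin 3) : pdC i (fun y : R3 => 2 * (y 2 : ℂ)) x = if i = 2 then 2 else 0 := by
    rw [pdC_const_mul hdz, pdC_coord]
    simp
  rw [divFld_smul hd2z hdX, divFld_cross_conj α hdS hdV, divFld_smul_e3 hdR,
    divFld_energyFlux ha hH hM, divFld_smul_conj α hdf hdV, hM, hV, e2, pdV_curlA α hH] at e1
  simp only [e3', hz] at e1
  have e7 : divFld (rellichFlux k α a H) x = -((-(x 2) * pdR 2 a x * nsq (curlA α H x) +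
      2 * a x * nsq (pdV 2 H x) : ℝ) : ℂ) -
      2 * ∑ i, (pdR i a x : ℂ) * (H x 2 * conj (pdV 2 H x i)) +
      ((x 2 * k ^ 2 : ℝ) : ℂ) * (dotc (H x) (pdV 2 H x) - conj (dotc (H x) (pdV 2 H x))) +
      ((x 2 * a x : ℝ) : ℂ) * (dotc (pdV 2 (curlA α H) x) (curlA α H x) -
        conj (dotc (pdV 2 (curlA α H) x) (curlA α H x))) := by
    rw [e1, dotc_conj, dotc_conj]
    push_cast
    rw [nsq_eq_dotc, nsq_eq_dotc]
    generalize pdV 2 (curlA α H) x = c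
    have e8 : crossC (fluxS α a H x) (conjV (pdV 2 H x)) 2 = (a x : ℂ) *
        ((pdA α 1 (fun y => H y 2) x - pdV 2 H x 1) * conj (pdV 2 H x 1) -
        (pdV 2 H x 0 - pdA α 0 (fun y => H y 2) x) * conj (pdV 2 H x 0)) := by
      rw [← e4, ← e5]
      simp only [crossC, fluxS, conjV, Matrix.cons_val, Pi.smul_apply, smul_eq_mul]
      ring
    have e9 : dotc ((k ^ 2 : ℂ) • H x) (pdV 2 H x) = (k : ℂ) ^ 2 * dotc (H x) (pdV 2 H x) := by
      simp [dotc, Finset.mul_sum, mul_assoc]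
    have e10 : dotc (fluxS α a H x) c = (a x : ℂ) * dotc (curlA α H x) c := by
      simp [dotc, fluxS, Finset.mul_sum, mul_assoc]
    have e11 : dotc (pdV 2 H x) (pdV 2 H x) = pdV 2 H x 0 * conj (pdV 2 H x 0) +
        pdV 2 H x 1 * conj (pdV 2 H x 1) + pdV 2 H x 2 * conj (pdV 2 H x 2) := by
      simp [dotc, Fin.sum_univ_three]
    simp only [Fin.sum_univ_three, ite_mul, zero_mul, e6, e9, e10, e11]
    simp only [Fin.isValue, e8, Fin.reduceEq, ↓reduceIte, map_zero]
    ring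
  have e12 (z : ℂ) (r : ℝ) : ((r : ℂ) * (z - conj z)).re = 0 := by
    simp
  rw [e7, Complex.add_re, Complex.add_re, e12, e12, rellichIntegrand, Complex.sub_re,
    Complex.neg_re, Complex.ofReal_re]
  simp
  ring

end Flux

section BoundaryFourier

open ComplexConjugate

/-- A continuous function on the square whose normalized integral is the sum of `T`. -/
def IsModeSum (T : ℤ × ℤ → ℂ) (f : ℝ × ℝ → ℂ) : Prop :=
  Continuous f ∧ HasSum T ((1 / (4 * (π : ℂ) ^ 2)) * ∫ p in sq2, f p)

theorem IsModeSum.add {T U : ℤ × ℤ → ℂ} {f g : ℝ × ℝ → ℂ} (hf : IsModeSum T f)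
    (hg : IsModeSum U g) : IsModeSum (fun n => T n + U n) (fun p => f p + g p) := by
  refine ⟨hf.1.add hg.1, ?_⟩
  rw [integral_add hf.1.integrableOn_sq2 hg.1.integrableOn_sq2, mul_add]
  exact hf.2.add hg.2

theorem IsModeSum.const_mul {T : ℤ × ℤ → ℂ} {f : ℝ × ℝ → ℂ} (c : ℂ) (hf : IsModeSum T f) :
    IsModeSum (fun n => c * T n) (fun p => c * f p) := by
  refine ⟨continuous_const.mul hf.1, ?_⟩
  rw [integral_const_mul, mul_left_comm]
  exact hf.2.mul_left c

theorem IsModeSum.sub {T U : ℤ × ℤ → ℂ} {f g : ℝ × ℝ → ℂ} (hf : IsModeSum T f)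
    (hg : IsModeSum U g) : IsModeSum (fun n => T n - U n) (fun p => f p - g p) := by
  simpa only [neg_one_mul, ← sub_eq_add_neg] using hf.add (hg.const_mul (-1))

theorem isModeSum_mul_conj {F G : ℝ × ℝ → ℂ} (hF : Continuous F) (hG : Continuous G) :
    IsModeSum (fun n => sqCoeff n F * conj (sqCoeff n G)) (fun p => F p * conj (G p)) :=
  ⟨hF.mul (Complex.continuous_conj.comp hG), hasSum_sqCoeff_mul_conj hF hG⟩

/-- The Fourier coefficients of the trace of a field at height `t`. -/
theorem fcoeff_eq_sqCoeff (F : R3 → C3) (n : ℤ × ℤ) (t : ℝ) (j : Fin 3) :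
    fcoeff F n t j = sqCoeff n fun p => F (bpt p t) j := rfl

theorem continuous_trace {F : R3 → C3} (hF : Continuous F) (t : ℝ) (j : Fin 3) :
    Continuous fun p => F (bpt p t) j :=
  (continuous_apply j).comp (hF.comp (continuous_bpt_left t))

theorem isModeSum_comp {F G : R3 → C3} (hF : Continuous F) (hG : Continuous G) (t : ℝ)
    (i j : Fin 3) : IsModeSum (fun n => fcoeff F n t i * conj (fcoeff G n t j))
      (fun p => F (bpt p t) i * conj (G (bpt p t) j)) :=
  isModeSum_mul_conj (continuous_trace hF t i) (continuous_trace hG t j)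

theorem isModeSum_dotc {F : R3 → C3} (hF : Continuous F) (t : ℝ) :
    IsModeSum (fun n => dotc (fcoeff F n t) (fcoeff F n t))
      (fun p => dotc (F (bpt p t)) (F (bpt p t))) := by
  simp only [dotc, Fin.sum_univ_three]
  exact ((isModeSum_comp hF hF t 0 0).add (isModeSum_comp hF hF t 1 1)).add
    (isModeSum_comp hF hF t 2 2)

theorem isModeSum_cross {F G : R3 → C3} (hF : Continuous F) (hG : Continuous G) (t : ℝ) :
    IsModeSum (fun n => crossC (fcoeff F n t) (conjV (fcoeff G n t)) 2)
      (fun p => crossC (F (bpt p t)) (conjV (G (bpt p t))) 2) :=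
  (isModeSum_comp hF hG t 0 1).sub (isModeSum_comp hF hG t 1 0)

/-- The shifted frequency `n + α`. -/
def freq (α : R3) (n : ℤ × ℤ) : R3 := ![n.1 + α 0, n.2 + α 1, 0]

theorem sqCoeff_pdA {α : R3} {F : R3 → ℂ} (hF : ContDiff ℝ 1 F) (hp : Biperiodic F) (n : ℤ × ℤ)
    (t : ℝ) {i : Fin 3} (hi : i ≠ 2) :
    sqCoeff n (fun p => pdA α i F (bpt p t)) =
      Complex.I * freq α n i * sqCoeff n (fun p => F (bpt p t)) := by
  have hc (j : Fin 3) : Continuous fun p => pdC j F (bpt p t) :=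
    (continuous_pdC hF j).comp (continuous_bpt_left t)
  have hF' : Continuous fun p => F (bpt p t) := hF.continuous.comp (continuous_bpt_left t)
  have h1 := sqCoeff_pdC hF hp n t
  unfold pdA
  have hm : Continuous fun p => Complex.I * (α i : ℂ) * F (bpt p t) := continuous_const.mul hF'
  rw [sqCoeff_add n (hc i) hm, sqCoeff_const_mul]
  fin_cases i
  · simp [h1.1, freq]
    ring
  · simp [h1.2, freq]
    ring
  · exact absurd rfl hi

theorem continuous_pdA {α : R3} {F : R3 → ℂ} (hF : ContDiff ℝ 1 F) (i : Fin 3) :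
    Continuous (pdA α i F) :=
  (continuous_pdC hF i).add (continuous_const.mul hF.continuous)

theorem curlA_eq_pdA {α : R3} (hα : α 2 = 0) (F : R3 → C3) (x : R3) :
    curlA α F x = ![pdA α 1 (fun y => F y 2) x - pdV 2 F x 1,
      pdV 2 F x 0 - pdA α 0 (fun y => F y 2) x,
      pdA α 0 (fun y => F y 1) x - pdA α 1 (fun y => F y 0) x] := by
  ext i
  fin_cases i <;>
  · simp [curlA, curlF, crossC, realToC3, pdA, pdV, hα]
    try ring

theorem divA_eq_pdA {α : R3} (hα : α 2 = 0) (F : R3 → C3) (x : R3) :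
    divA α F x = pdA α 0 (fun y => F y 0) x + pdA α 1 (fun y => F y 1) x + pdV 2 F x 2 := by
  simp [divA, divFld, Fin.sum_univ_three, pdA, pdV, hα]
  ring

variable {h k : ℝ} {α : R3} {a : R3 → ℝ} {H : R3 → C3}

theorem fcoeff_curlA (hα : α 2 = 0) (hH : ContDiff ℝ 2 H) (hp : Biperiodic H) (n : ℤ × ℤ)
    (t : ℝ) : fcoeff (curlA α H) n t =
      ![Complex.I * freq α n 1 * fcoeff H n t 2 - fcoeff (pdV 2 H) n t 1,
        fcoeff (pdV 2 H) n t 0 - Complex.I * freq α n 0 * fcoeff H n t 2,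
        Complex.I * freq α n 0 * fcoeff H n t 1 - Complex.I * freq α n 1 * fcoeff H n t 0] := by
  have hH1 (j : Fin 3) : ContDiff ℝ 1 fun y => H y j := (hH.comp_apply j).of_le (by norm_num)
  have hA (i j : Fin 3) : Continuous fun p => pdA α i (fun y => H y j) (bpt p t) :=
    (continuous_pdA (hH1 j) i).comp (continuous_bpt_left t)
  have hV := continuous_trace (contDiff_pdV hH 2).continuous t
  have h0 (j : Fin 3) := sqCoeff_pdA (α := α) (hH1 j) (hp.comp_apply j) n t (i := 0) (by decide)
  have h1 (j : Fin 3) := sqCoeff_pdA (α := α) (hH1 j) (hp.comp_apply j) n t (i := 1) (by decide)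
  ext i
  simp only [fcoeff_eq_sqCoeff, curlA_eq_pdA hα, ← h0, ← h1]
  fin_cases i
  · exact sqCoeff_sub n (hA 1 2) (hV 1)
  · exact sqCoeff_sub n (hV 0) (hA 0 2)
  · exact sqCoeff_sub n (hA 0 1) (hA 1 0)

theorem fcoeff_divA (hα : α 2 = 0) (hH : ContDiff ℝ 2 H) (hp : Biperiodic H) (n : ℤ × ℤ)
    (t : ℝ) : sqCoeff n (fun p => divA α H (bpt p t)) =
      Complex.I * freq α n 0 * fcoeff H n t 0 + Complex.I * freq α n 1 * fcoeff H n t 1 +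
        fcoeff (pdV 2 H) n t 2 := by
  have hH1 (j : Fin 3) : ContDiff ℝ 1 fun y => H y j := (hH.comp_apply j).of_le (by norm_num)
  have hA (i j : Fin 3) : Continuous fun p => pdA α i (fun y => H y j) (bpt p t) :=
    (continuous_pdA (hH1 j) i).comp (continuous_bpt_left t)
  have hV := continuous_trace (contDiff_pdV hH 2).continuous t
  have hs : Continuous fun p => pdA α 0 (fun y => H y 0) (bpt p t) +
      pdA α 1 (fun y => H y 1) (bpt p t) := (hA 0 0).add (hA 1 1)
  simp only [fcoeff_eq_sqCoeff, divA_eq_pdA hα]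
  rw [sqCoeff_add n hs (hV 2), sqCoeff_add n (hA 0 0) (hA 1 1),
    sqCoeff_pdA (hH1 0) (hp.comp_apply 0) n t (by decide),
    sqCoeff_pdA (hH1 1) (hp.comp_apply 1) n t (by decide)]

theorem IsHomSol.fcoeff_pdV (hH : IsHomSol h k α a H) (n : ℤ × ℤ) :
    fcoeff (pdV 2 H) n h = (Complex.I * betaN k α n) • fcoeff H n h := by
  ext j
  have h1 : HasDerivAt (fun t => fcoeff H n t j) (fcoeff (pdV 2 H) n h j) h :=
    hasDerivAt_sqCoeff ((hH.smooth.comp_apply j).of_le (by norm_num)) n h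
  exact h1.deriv.symm.trans (hH.radiation n j)

theorem I_mul_betaN (k : ℝ) (α : R3) (n : ℤ × ℤ) :
    (Complex.I * betaN k α n).re ≤ 0 ∧ 0 ≤ (Complex.I * betaN k α n).im ∧
      (Complex.I * betaN k α n) ^ 2 = (freq α n 0 ^ 2 + freq α n 1 ^ 2 - k ^ 2 : ℝ) := by
  unfold betaN
  split_ifs with hle
  · refine ⟨by simp, by simp [Real.sqrt_nonneg], ?_⟩
    rw [mul_pow, ← Complex.ofReal_pow, Real.sq_sqrt (by linarith), Complex.I_sq]
    simp [freq]
  · refine ⟨by simp [← mul_assoc, Real.sqrt_nonneg], by simp [← mul_assoc], ?_⟩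
    rw [← mul_assoc, mul_pow, ← Complex.ofReal_pow, Real.sq_sqrt (by linarith),
      Complex.I_mul_I]
    simp [freq]

theorem IsHomSol.divA_top (hh : 0 < h) (hH : IsHomSol h k α a H) {x : R3}
    (hx : x ∈ closedCell h) : divA α H x = 0 := by
  rw [← closure_Omg hh] at hx
  have hc : Continuous (divA α H) := continuous_divA α (hH.smooth.of_le (by norm_num))
  exact (isClosed_singleton.preimage hc).closure_subset_iff.2 (fun y hy => hH.divfree y hy) hx

theorem bpt_mem_closedCell {p : ℝ × ℝ} (hp : p ∈ sq2) {t : ℝ} (ht : t ∈ Set.Icc 0 h) :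
    bpt p t ∈ closedCell h :=
  mem_closedCell.2 ⟨Set.Ioo_subset_Icc_self hp.1, Set.Ioo_subset_Icc_self hp.2, ht⟩

theorem IsHomSol.fcoeff_div (hh : 0 < h) (hα : α 2 = 0) (hH : IsHomSol h k α a H) (n : ℤ × ℤ) :
    Complex.I * freq α n 0 * fcoeff H n h 0 + Complex.I * freq α n 1 * fcoeff H n h 1 +
      Complex.I * betaN k α n * fcoeff H n h 2 = 0 := by
  have h1 := fcoeff_divA hα hH.smooth hH.periodic n h
  rw [hH.fcoeff_pdV] at h1
  refine h1.symm.trans ?_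
  have : ∀ p ∈ sq2, divA α H (bpt p h) * Complex.exp (-Complex.I *
      (((n.1 : ℝ) * p.1 + (n.2 : ℝ) * p.2 : ℝ) : ℂ)) = 0 := fun p hp => by
    rw [hH.divA_top hh (bpt_mem_closedCell hp ⟨hh.le, le_rfl⟩), zero_mul]
  rw [sqCoeff, setIntegral_congr_fun measurableSet_sq2 this]
  simp

/-- Energy flux of a single mode with vertical propagation constant `γ`. -/
theorem mode_energy {γ : ℂ} {μ X c : C3} (hμ : ∀ i, conj (μ i) = -μ i)
    (hd : μ 0 * X 0 + μ 1 * X 1 + γ * X 2 = 0)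
    (hc : c = ![μ 1 * X 2 - γ * X 1, γ * X 0 - μ 0 * X 2, μ 0 * X 1 - μ 1 * X 0]) :
    crossC c (conjV X) 2 = -γ * (X 0 * conj (X 0) + X 1 * conj (X 1)) +
      conj γ * (X 2 * conj (X 2)) := by
  have hd' := congrArg conj hd
  simp only [map_add, map_mul, hμ, map_zero] at hd'
  subst hc
  simp [crossC, conjV]
  linear_combination X 2 * (-hd')

/-- Rellich flux of a single mode with real vertical propagation constant `γ`. -/
theorem mode_rellich {γ : ℂ} {μ X c : C3} (t k : ℂ) (hμ : ∀ i, conj (μ i) = -μ i)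
    (hγ : conj γ = γ) (hk : γ ^ 2 = -μ 0 ^ 2 - μ 1 ^ 2 - k ^ 2)
    (hd : μ 0 * X 0 + μ 1 * X 1 + γ * X 2 = 0)
    (hc : c = ![μ 1 * X 2 - γ * X 1, γ * X 0 - μ 0 * X 2, μ 0 * X 1 - μ 1 * X 0]) :
    2 * t * crossC c (conjV (γ • X)) 2 + t * (dotc c c - k ^ 2 * dotc X X) +
      crossC c (conjV X) 2 + -2 * (X 2 * conj ((γ • X) 2)) = -γ * dotc X X := by
  have h1 := mode_energy hμ hd hc
  have h2 : crossC c (conjV (γ • X)) 2 = γ * crossC c (conjV X) 2 := by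
    simp [crossC, conjV, hγ]
    ring
  have hd' := congrArg conj hd
  simp only [map_add, map_mul, hμ, hγ, map_zero] at hd'
  have h3 : dotc c c =
      (-μ 0 ^ 2 - μ 1 ^ 2 + γ ^ 2) * dotc X X - 4 * γ ^ 2 * (X 2 * conj (X 2)) := by
    subst hc
    simp [dotc, Fin.sum_univ_three, hμ, hγ]
    linear_combination (2 * γ * conj (X 2) - (-μ 0 * conj (X 0) + -μ 1 * conj (X 1) +
      γ * conj (X 2))) * hd + 2 * γ * X 2 * hd'
  rw [h2, h1, h3, hγ]
  simp [dotc, Fin.sum_univ_three, hγ]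
  linear_combination (-t * (X 0 * conj (X 0) + X 1 * conj (X 1) + X 2 * conj (X 2))) * hk

end BoundaryFourier

section BoundaryTerms

open ComplexConjugate

variable {h k : ℝ} {α : R3} {a : R3 → ℝ} {H : R3 → C3}

theorem conj_I_mul_freq (α : R3) (n : ℤ × ℤ) (i : Fin 3) :
    conj (Complex.I * (freq α n i : ℂ)) = -(Complex.I * (freq α n i : ℂ)) := by
  simp

theorem IsHomSol.fcoeff_curlA_top (hα : α 2 = 0) (hH : IsHomSol h k α a H) (n : ℤ × ℤ) :
    fcoeff (curlA α H) n h =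
      ![Complex.I * freq α n 1 * fcoeff H n h 2 - Complex.I * betaN k α n * fcoeff H n h 1,
        Complex.I * betaN k α n * fcoeff H n h 0 - Complex.I * freq α n 0 * fcoeff H n h 2,
        Complex.I * freq α n 0 * fcoeff H n h 1 - Complex.I * freq α n 1 * fcoeff H n h 0] := by
  rw [fcoeff_curlA hα hH.smooth hH.periodic, hH.fcoeff_pdV]
  rfl

theorem EpsOK.eq_one_top (ha : EpsOK h a) (p : ℝ × ℝ) : a (bpt p h) = 1 := by
  obtain ⟨η, h0, -, h1⟩ := ha.one_near_top
  exact h1 _ (by simpa [bpt] using h0)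

theorem IsHomSol.curlA_fluxS (hH : IsHomSol h k α a H) {x : R3} (hx : x ∈ Omg h) :
    curlA α (fluxS α a H) x = (k ^ 2 : ℂ) • H x :=
  hH.maxwell x hx

theorem IsHomSol.fluxS_bottom (hH : IsHomSol h k α a H) (p : ℝ × ℝ) :
    fluxS α a H (bpt p 0) 0 = 0 ∧ fluxS α a H (bpt p 0) 1 = 0 := by
  have h1 := hH.bc_tangential (bpt p 0) (by simp [bpt])
  have h2 := congrFun h1 0
  have h3 := congrFun h1 1
  simp only [crossC, e3, Matrix.cons_val_zero, Matrix.cons_val_one, Matrix.cons_val, zero_mul,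
    one_mul, zero_sub, sub_zero, Pi.zero_apply, neg_eq_zero] at h2 h3
  exact ⟨h3, h2⟩

theorem IsHomSol.energyFlux_bottom (hH : IsHomSol h k α a H) (p : ℝ × ℝ) :
    energyFlux α a H (bpt p 0) 2 = 0 := by
  simp [energyFlux, crossC, (hH.fluxS_bottom p).1, (hH.fluxS_bottom p).2]

theorem IsHomSol.rellichFlux_bottom (hH : IsHomSol h k α a H) (p : ℝ × ℝ) :
    rellichFlux k α a H (bpt p 0) 2 = 0 := by
  have h1 : H (bpt p 0) 2 = 0 := hH.bc_normal _ (by simp [bpt])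
  have h2 : bpt p 0 2 = 0 := by simp [bpt]
  simp [rellichFlux, rellichDensity, h1, h2, hH.energyFlux_bottom p]

theorem EpsOK.energyFlux_top (ha : EpsOK h a) (p : ℝ × ℝ) :
    energyFlux α a H (bpt p h) 2 = crossC (curlA α H (bpt p h)) (conjV (H (bpt p h))) 2 := by
  simp [energyFlux, fluxS, ha.eq_one_top p]

theorem EpsOK.rellichFlux_top (ha : EpsOK h a) (p : ℝ × ℝ) :
    rellichFlux k α a H (bpt p h) 2 =
      2 * (h : ℂ) * crossC (curlA α H (bpt p h)) (conjV (pdV 2 H (bpt p h))) 2 +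
      h * (dotc (curlA α H (bpt p h)) (curlA α H (bpt p h)) -
        (k : ℂ) ^ 2 * dotc (H (bpt p h)) (H (bpt p h))) +
      crossC (curlA α H (bpt p h)) (conjV (H (bpt p h))) 2 +
      -2 * (H (bpt p h) 2 * conj (pdV 2 H (bpt p h) 2)) := by
  have h2 : bpt p h 2 = h := by simp [bpt]
  simp only [rellichFlux, Pi.add_apply, Pi.smul_apply, smul_eq_mul, rellichDensity, h2,
    ha.eq_one_top p, ha.energyFlux_top p, fluxS, e3, conjV, Matrix.cons_val, Complex.ofReal_one,
    one_smul, one_mul, mul_one, mul_assoc]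

theorem four_pi_sq_pos : 0 < 1 / (4 * π ^ 2) := by positivity

theorem IsHomSol.im_integral_energyFlux_top (hh : 0 < h) (ha : EpsOK h a)
    (hH : IsHomSol h k α a H) :
    (∫ p in sq2, crossC (curlA α H (bpt p h)) (conjV (H (bpt p h))) 2).im = 0 := by
  have h1 := integral_divFld hh (contDiff_energyFlux (α := α) ha.smooth hH.smooth)
    (Biperiodic.energyFlux ha.periodic hH.periodic)
  simp only [hH.energyFlux_bottom, ha.energyFlux_top, integral_zero, sub_zero] at h1
  have h2 : ∀ x ∈ Omg h, divFld (energyFlux α a H) x =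
      ((k ^ 2 * nsq (H x) - a x * nsq (curlA α H x) : ℝ) : ℂ) := fun x hx => by
    rw [divFld_energyFlux ha.smooth hH.smooth (hH.curlA_fluxS hx)]
    push_cast
    rw [nsq_eq_dotc, nsq_eq_dotc]
  rw [← h1, setIntegral_congr_fun (isOpen_Omg h).measurableSet h2, integral_complex_ofReal,
    Complex.ofReal_im]

theorem dotc_self_eq_zero {v : C3} (hv : nsq v = 0) : v = 0 := by
  have h1 := (Finset.sum_eq_zero_iff_of_nonneg fun i _ => Complex.normSq_nonneg (v i)).1 hv
  ext i
  exact Complex.normSq_eq_zero.1 (h1 i (Finset.mem_univ i))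

theorem nsq_nonneg (v : C3) : 0 ≤ nsq v :=
  Finset.sum_nonneg fun i _ => Complex.normSq_nonneg (v i)

/-- Propagating modes of a homogeneous radiating solution vanish. -/
theorem IsHomSol.im_betaN_or (hh : 0 < h) (hα : α 2 = 0) (ha : EpsOK h a)
    (hH : IsHomSol h k α a H) (n : ℤ × ℤ) :
    (Complex.I * betaN k α n).im = 0 ∨ fcoeff H n h = 0 := by
  have h1 := (isModeSum_cross (contDiff_curlA α hH.smooth).continuous hH.smooth.continuous h).2
  have h2 : ∀ n, crossC (fcoeff (curlA α H) n h) (conjV (fcoeff H n h)) 2 =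
      -(Complex.I * betaN k α n) * (fcoeff H n h 0 * conj (fcoeff H n h 0) +
        fcoeff H n h 1 * conj (fcoeff H n h 1)) +
      conj (Complex.I * betaN k α n) * (fcoeff H n h 2 * conj (fcoeff H n h 2)) := fun n =>
    mode_energy (μ := fun i => Complex.I * freq α n i) (conj_I_mul_freq α n)
      (hH.fcoeff_div hh hα n) (hH.fcoeff_curlA_top hα n)
  have h3 : ∀ n, (crossC (fcoeff (curlA α H) n h) (conjV (fcoeff H n h)) 2).im =
      -((Complex.I * betaN k α n).im * nsq (fcoeff H n h)) := fun n => by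
    rw [h2, Complex.mul_conj, Complex.mul_conj, Complex.mul_conj]
    generalize Complex.I * betaN k α n = γ
    rw [← Complex.ofReal_add, Complex.add_im, Complex.im_mul_ofReal, Complex.im_mul_ofReal]
    simp [nsq, Fin.sum_univ_three]
    ring
  have h4 := Complex.hasSum_im h1
  simp only [h3] at h4
  have h5 : ((1 / (4 * (π : ℂ) ^ 2)) *
      ∫ p in sq2, crossC (curlA α H (bpt p h)) (conjV (H (bpt p h))) 2).im = 0 := by
    have : (1 / (4 * (π : ℂ) ^ 2)) = ((1 / (4 * π ^ 2) : ℝ) : ℂ) := by push_cast; rfl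
    rw [this, Complex.im_ofReal_mul, hH.im_integral_energyFlux_top hh ha, mul_zero]
  rw [h5] at h4
  have h6 := h4.neg
  simp only [neg_neg, neg_zero] at h6
  have h7 := (hasSum_zero_iff_of_nonneg fun n =>
    mul_nonneg (I_mul_betaN k α n).2.1 (nsq_nonneg (fcoeff H n h))).1 h6
  exact (mul_eq_zero.1 (congrFun h7 n)).imp id dotc_self_eq_zero

theorem IsHomSol.re_integral_rellichFlux_top (hh : 0 < h) (hα : α 2 = 0) (ha : EpsOK h a)
    (hH : IsHomSol h k α a H) : 0 ≤ (∫ p in sq2, rellichFlux k α a H (bpt p h) 2).re := by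
  have hC := (contDiff_curlA α hH.smooth).continuous
  have hV := (contDiff_pdV hH.smooth 2).continuous
  have hH0 := hH.smooth.continuous
  have h1 := (((((isModeSum_cross hC hV h).const_mul (2 * (h : ℂ))).add
    (((isModeSum_dotc hC h).sub ((isModeSum_dotc hH0 h).const_mul ((k : ℂ) ^ 2))).const_mul
      (h : ℂ))).add (isModeSum_cross hC hH0 h)).add
    ((isModeSum_comp hH0 hV h 2 2).const_mul (-2))).2
  simp only [← ha.rellichFlux_top] at h1
  have h2 : ∀ n, 0 ≤ (2 * (h : ℂ) * crossC (fcoeff (curlA α H) n h)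
        (conjV (fcoeff (pdV 2 H) n h)) 2 +
      h * (dotc (fcoeff (curlA α H) n h) (fcoeff (curlA α H) n h) -
        (k : ℂ) ^ 2 * dotc (fcoeff H n h) (fcoeff H n h)) +
      crossC (fcoeff (curlA α H) n h) (conjV (fcoeff H n h)) 2 +
      -2 * (fcoeff H n h 2 * conj (fcoeff (pdV 2 H) n h 2))).re := fun n => by
    rcases hH.im_betaN_or hh hα ha n with h3 | h3
    · have h4 : conj (Complex.I * betaN k α n) = Complex.I * betaN k α n :=
        Complex.conj_eq_iff_im.2 h3
      have h5 : (Complex.I * betaN k α n) ^ 2 = -(Complex.I * (freq α n 0 : ℂ)) ^ 2 -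
          (Complex.I * (freq α n 1 : ℂ)) ^ 2 - (k : ℂ) ^ 2 := by
        rw [(I_mul_betaN k α n).2.2, mul_pow, mul_pow, Complex.I_sq]
        push_cast
        ring
      rw [hH.fcoeff_pdV, mode_rellich (μ := fun i => Complex.I * freq α n i) h k
        (conj_I_mul_freq α n) h4 h5 (hH.fcoeff_div hh hα n) (hH.fcoeff_curlA_top hα n),
        ← nsq_eq_dotc, Complex.re_mul_ofReal, Complex.neg_re]
      exact mul_nonneg (neg_nonneg.2 (I_mul_betaN k α n).1) (nsq_nonneg _)
    · rw [hH.fcoeff_curlA_top hα, hH.fcoeff_pdV, h3]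
      simp [crossC, dotc, conjV, Fin.sum_univ_three]
  have h3 := (Complex.hasSum_re h1).nonneg h2
  have : (1 / (4 * (π : ℂ) ^ 2)) = ((1 / (4 * π ^ 2) : ℝ) : ℂ) := by push_cast; rfl
  rw [this, Complex.re_ofReal_mul] at h3
  exact nonneg_of_mul_nonneg_right h3 four_pi_sq_pos

theorem continuous_nsq_comp {F : R3 → C3} (hF : Continuous F) : Continuous fun y => nsq (F y) :=
  continuous_finsetSum _ fun j _ => Complex.continuous_normSq.comp ((continuous_apply j).comp hF)

theorem continuous_rellichIntegrand (ha : ContDiff ℝ 1 a) (hH : ContDiff ℝ 2 H) :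
    Continuous (rellichIntegrand α a H) := by
  have hC := continuous_nsq_comp (contDiff_curlA α hH).continuous
  have hV := (contDiff_pdV hH 2).continuous
  have hV2 := continuous_nsq_comp hV
  have hVi (i : Fin 3) : Continuous fun y => conj (pdV 2 H y i) :=
    Complex.continuous_conj.comp ((continuous_apply i).comp hV)
  have hp := continuous_pdR ha
  have hH2 : Continuous fun y => H y 2 := (hH.comp_apply 2).continuous
  have hac := ha.continuous
  unfold rellichIntegrand
  refine ((((continuous_apply 2).neg.mul (hp 2)).mul hC).add
    ((continuous_const.mul hac).mul hV2)).add (continuous_const.mul (Complex.continuous_re.comp ?_))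
  exact continuous_finsetSum _ fun i _ =>
    (Complex.continuous_ofReal.comp (hp i)).mul (hH2.mul (hVi i))

theorem Continuous.integrableOn_Omg {E : Type*} [NormedAddCommGroup E] {f : R3 → E}
    (hf : Continuous f) : IntegrableOn f (Omg h) :=
  (hf.continuousOn.integrableOn_compact (isCompact_closedCell h)).mono_set
    (Omg_subset_closedCell h)

theorem IsHomSol.divA_pdV_eq_zero (hH : IsHomSol h k α a H) {x : R3} (hx : x ∈ Omg h) :
    divA α (pdV 2 H) x = 0 := by
  have : divA α H =ᶠ[nhds x] fun _ => 0 :=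
    Filter.eventually_of_mem ((isOpen_Omg h).mem_nhds hx) hH.divfree
  rw [divA_pdV α hH.smooth, pdC, this.fderiv_eq]
  simp

theorem IsHomSol.integral_rellichIntegrand (hh : 0 < h) (hα : α 2 = 0) (ha : EpsOK h a)
    (hH : IsHomSol h k α a H) : ∫ x in Omg h, rellichIntegrand α a H x ≤ 0 := by
  have h1 := integral_divFld hh (contDiff_rellichFlux (k := k) (α := α) ha.smooth hH.smooth)
    (Biperiodic.rellichFlux ha.periodic hH.periodic)
  simp only [hH.rellichFlux_bottom, integral_zero, sub_zero] at h1
  have hi : IntegrableOn (divFld (rellichFlux k α a H)) (Omg h) :=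
    (continuous_divFld (contDiff_rellichFlux ha.smooth hH.smooth)).integrableOn_Omg
  have h2 : ∫ x in Omg h, (divFld (rellichFlux k α a H) x).re =
      (∫ p in sq2, rellichFlux k α a H (bpt p h) 2).re := by
    rw [← h1]
    exact integral_re hi
  have h3 : ∀ x ∈ Omg h, (divFld (rellichFlux k α a H) x).re = -rellichIntegrand α a H x :=
    fun x hx => re_divFld_rellichFlux ha.smooth hH.smooth hα (hH.curlA_fluxS hx)
      (hH.divA_pdV_eq_zero hx)
  rw [setIntegral_congr_fun (isOpen_Omg h).measurableSet h3, integral_neg] at h2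
  have := hH.re_integral_rellichFlux_top hh hα ha
  linarith

end BoundaryTerms

section RiccatiWeight

open ComplexConjugate

/-- The solution of `w' = -1 - 2 w² / h²` with `w h = 0`. -/
def riccatiWeight (h t : ℝ) : ℝ := h / √2 * Real.tan (√2 * (1 - t / h))

variable {h k : ℝ} {α : R3} {a : R3 → ℝ} {H : R3 → C3}

theorem riccatiWeight_top (hh : 0 < h) : riccatiWeight h h = 0 := by
  simp [riccatiWeight, div_self hh.ne']

theorem cos_riccati_ne_zero (hh : 0 < h) {t : ℝ} (ht : t ∈ Set.Icc 0 h) :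
    Real.cos (√2 * (1 - t / h)) ≠ 0 := by
  have h2 : 0 ≤ √2 := Real.sqrt_nonneg 2
  have h3 : √2 < 3 / 2 := by
    rw [Real.sqrt_lt' (by norm_num)]
    norm_num
  have h4 : t / h ≤ 1 := (div_le_one hh).2 ht.2
  have h5 : 0 ≤ t / h := div_nonneg ht.1 hh.le
  refine (Real.cos_pos_of_mem_Ioo ⟨?_, ?_⟩).ne'
  · nlinarith [Real.pi_pos, mul_nonneg h2 (sub_nonneg.2 h4)]
  · nlinarith [Real.pi_gt_three, mul_nonneg h2 h5]

theorem hasDerivAt_riccatiWeight (hh : 0 < h) {t : ℝ} (ht : t ∈ Set.Icc 0 h) :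
    HasDerivAt (riccatiWeight h) (-1 - 2 * riccatiWeight h t ^ 2 / h ^ 2) t := by
  have hc := cos_riccati_ne_zero hh ht
  have h1 : HasDerivAt (fun t => √2 * (1 - t / h)) (√2 * (-(1 / h))) t := by
    simpa using (((hasDerivAt_id t).div_const h).const_sub 1).const_mul √2
  have h2 : HasDerivAt (riccatiWeight h) _ t :=
    ((Real.hasDerivAt_tan hc).comp t h1).const_mul (h / √2)
  refine h2.congr_deriv (Eq.symm ?_)
  have h3 : (√2) ^ 2 = 2 := Real.sq_sqrt (by norm_num)
  have h4 : √2 ≠ 0 := by positivity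
  have h5 : 1 / Real.cos (√2 * (1 - t / h)) ^ 2 = 1 + Real.tan (√2 * (1 - t / h)) ^ 2 := by
    rw [one_div, ← Real.inv_one_add_tan_sq hc, inv_inv]
  rw [h5, riccatiWeight]
  field_simp
  rw [h3]
  ring

theorem continuousOn_riccatiWeight_coord (hh : 0 < h) :
    ContinuousOn (fun x : R3 => riccatiWeight h (x 2)) (closedCell h) :=
  fun _ hx => (ContinuousAt.comp (f := fun x : R3 => x 2) (hasDerivAt_riccatiWeight hh
    (mem_closedCell.1 hx).2.2).continuousAt (continuous_apply 2).continuousAt).continuousWithinAt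

theorem pdR_normSq {f : R3 → ℂ} {x : R3} (hf : DifferentiableAt ℝ f x) (i : Fin 3) :
    DifferentiableAt ℝ (fun y => Complex.normSq (f y)) x ∧
      pdR i (fun y => Complex.normSq (f y)) x = 2 * (f x * conj (pdC i f x)).re := by
  have h1 : (fun y => ((Complex.normSq (f y) : ℝ) : ℂ)) = fun y => f y * conj (f y) :=
    funext fun y => (Complex.mul_conj _).symm
  have hd : DifferentiableAt ℝ (fun y => Complex.normSq (f y)) x := by
    have h2 := Complex.reCLM.differentiableAt.comp x (hf.fun_mul hf.conjC)
    rw [← h1] at h2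
    exact h2
  refine ⟨hd, ?_⟩
  have h2 := pdC_ofReal hd i
  rw [h1, pdC_mul hf hf.conjC, pdC_conj hf] at h2
  have h3 := congrArg Complex.re h2
  rw [Complex.ofReal_re] at h3
  rw [← h3]
  simp
  ring

/-- The vertical derivative of `w |H₃|²`. -/
def weightIntegrand (h : ℝ) (H : R3 → C3) (x : R3) : ℝ :=
  (-1 - 2 * riccatiWeight h (x 2) ^ 2 / h ^ 2) * Complex.normSq (H x 2) +
    riccatiWeight h (x 2) * (2 * (H x 2 * conj (pdV 2 H x 2)).re)

theorem continuousOn_weightIntegrand (hh : 0 < h) (hH : ContDiff ℝ 2 H) :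
    ContinuousOn (weightIntegrand h H) (closedCell h) := by
  have hw := continuousOn_riccatiWeight_coord hh
  have hH2 : Continuous fun y => H y 2 := (hH.comp_apply 2).continuous
  have hV : Continuous fun y => conj (pdV 2 H y 2) :=
    Complex.continuous_conj.comp ((contDiff_pdV hH 2).comp_apply 2).continuous
  exact ((continuousOn_const.sub ((continuousOn_const.mul (hw.pow 2)).div_const _)).mul
    (Complex.continuous_normSq.comp hH2).continuousOn).add (hw.mul
      (continuous_const.mul (Complex.continuous_re.comp (hH2.mul hV))).continuousOn)

theorem integral_weightIntegrand (hh : 0 < h) (hH : ContDiff ℝ 2 H)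
    (hb : ∀ x : R3, x 2 = 0 → H x 2 = 0) : ∫ x in Omg h, weightIntegrand h H x = 0 := by
  have hH2 : Continuous fun y => H y 2 := (hH.comp_apply 2).continuous
  have hd (x : R3) : DifferentiableAt ℝ (fun y => H y 2) x :=
    (hH.comp_apply 2).differentiable (by norm_num) x
  set Φ : Fin 3 → R3 → ℝ := ![fun _ => 0, fun _ => 0,
    fun x => riccatiWeight h (x 2) * Complex.normSq (H x 2)] with hΦ
  have hΦ2 (x : R3) (hx : x ∈ Omg h) : HasFDerivAt (Φ 2)
      (riccatiWeight h (x 2) • fderiv ℝ (fun y => Complex.normSq (H y 2)) x +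
        Complex.normSq (H x 2) • ((-1 - 2 * riccatiWeight h (x 2) ^ 2 / h ^ 2) •
          (ContinuousLinearMap.proj 2 : R3 →L[ℝ] ℝ))) x := by
    have h1 := HasDerivAt.comp_hasFDerivAt (f := fun y : R3 => y 2) x
      (hasDerivAt_riccatiWeight hh (Set.Ioo_subset_Icc_self hx.2.2))
      (hasFDerivAt_apply (𝕜 := ℝ) (2 : Fin 3) x)
    exact h1.mul (pdR_normSq (hd x) 2).1.hasFDerivAt
  have key := integral_div_cell hh Φ (weightIntegrand h H) ?_ ?_ ?_
    (continuousOn_weightIntegrand hh hH) (fun _ => ⟨rfl, rfl⟩) (fun _ => ⟨rfl, rfl⟩)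
  · have h0 (p : ℝ × ℝ) : Φ 2 (bpt p h) = 0 := by
      simp [hΦ, bpt, riccatiWeight_top hh]
    have h1 (p : ℝ × ℝ) : Φ 2 (bpt p 0) = 0 := by
      simp [hΦ, hb (bpt p 0) (by simp [bpt])]
    simpa only [h0, h1, integral_zero, sub_zero] using key
  · intro i
    fin_cases i
    · exact continuousOn_const
    · exact continuousOn_const
    · exact (continuousOn_riccatiWeight_coord hh).mul
        (Complex.continuous_normSq.comp hH2).continuousOn
  · intro i x hx
    fin_cases i
    · exact differentiableAt_const _
    · exact differentiableAt_const _
    · exact (hΦ2 x hx).differentiableAt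
  · intro x hx
    have e0 : fderiv ℝ (Φ 0) x (Pi.single 0 1) = 0 := by simp [hΦ]
    have e1 : fderiv ℝ (Φ 1) x (Pi.single 1 1) = 0 := by simp [hΦ]
    have e2 := (pdR_normSq (hd x) 2).2
    rw [pdR] at e2
    rw [Fin.sum_univ_three, e0, e1, (hΦ2 x hx).fderiv]
    simp only [add_apply, smul_apply, e2, smul_eq_mul,
      ContinuousLinearMap.proj_apply, Pi.single_eq_same, weightIntegrand, pdV]
    ring

end RiccatiWeight

section Coercivity

open ComplexConjugate

theorem neg_le_two_mul_re {δ : ℝ} (hδ : 0 < δ) (p : ℝ) (z v : ℂ) :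
    -(δ * p ^ 2 * Complex.normSq z + 1 / δ * Complex.normSq v) ≤ 2 * (p * (z * conj v).re) := by
  have h1 : 0 ≤ Complex.normSq ((δ * p : ℝ) * z + v) / δ :=
    div_nonneg (Complex.normSq_nonneg _) hδ.le
  have h2 : Complex.normSq ((δ * p : ℝ) * z + v) / δ =
      δ * p ^ 2 * Complex.normSq z + 1 / δ * Complex.normSq v + 2 * (p * (z * conj v).re) := by
    simp only [Complex.normSq_apply, Complex.add_re, Complex.add_im, Complex.mul_re, Complex.mul_im,
      Complex.ofReal_re, Complex.ofReal_im, Complex.conj_re, Complex.conj_im]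
    field_simp
    ring
  linarith

theorem neg_le_two_mul_re_of_abs_le {s M p : ℝ} (hs : 0 < s) (hp : |p| ≤ M) (z v : ℂ) :
    -(M * (s * Complex.normSq z + 1 / s * Complex.normSq v)) ≤ 2 * (p * (z * conj v).re) := by
  have h1 := neg_le_two_mul_re hs 1 z v
  have h2 := neg_le_two_mul_re hs (-1) z v
  have h3 : |2 * (z * conj v).re| ≤ s * Complex.normSq z + 1 / s * Complex.normSq v := by
    rw [abs_le]
    constructor <;> linarith
  have h4 : |p * (2 * (z * conj v).re)| ≤
      M * (s * Complex.normSq z + 1 / s * Complex.normSq v) := by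
    rw [abs_mul]
    exact mul_le_mul hp h3 (abs_nonneg _) ((abs_nonneg _).trans hp)
  linarith [(abs_le.1 h4).1]

theorem weight_le {h : ℝ} (hh : 0 < h) (w : ℝ) (z v : ℂ) :
    Complex.normSq z - h ^ 2 / 2 * Complex.normSq v ≤
      -((-1 - 2 * w ^ 2 / h ^ 2) * Complex.normSq z + w * (2 * (z * conj v).re)) := by
  have h1 := neg_le_two_mul_re (δ := 2 / h ^ 2) (by positivity) (-w) z v
  have h2 : 2 / h ^ 2 * (-w) ^ 2 = 2 * w ^ 2 / h ^ 2 := by ring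
  rw [h2, one_div_div] at h1
  linarith

variable {h k : ℝ} {α : R3} {a : R3 → ℝ} {H : R3 → C3}

theorem hasDerivAt_bpt (p : ℝ × ℝ) (t : ℝ) : HasDerivAt (bpt p) (Pi.single 2 1) t := by
  refine hasDerivAt_pi.2 fun i => ?_
  fin_cases i
  · simpa [bpt] using hasDerivAt_const t p.1
  · simpa [bpt] using hasDerivAt_const t p.2
  · exact hasDerivAt_id' t

theorem bpt_coord (x : R3) : bpt (x 0, x 1) (x 2) = x := by
  ext i
  fin_cases i <;> rfl

theorem EpsOK.one_le (ha : EpsOK h a) (hmono : ∀ x ∈ Omg h, pdR 2 a x ≤ 0) {x : R3}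
    (hx : x ∈ Omg h) : 1 ≤ a x := by
  have hd (t : ℝ) : HasDerivAt (fun t => a (bpt (x 0, x 1) t)) (pdR 2 a (bpt (x 0, x 1) t)) t :=
    (ha.smooth.differentiable (by norm_num) _).hasFDerivAt.comp_hasDerivAt t
      (hasDerivAt_bpt _ t)
  have hanti : AntitoneOn (fun t => a (bpt (x 0, x 1) t)) (Set.Icc (x 2) h) := by
    refine antitoneOn_of_deriv_nonpos (convex_Icc _ _)
      (fun t _ => (hd t).continuousAt.continuousWithinAt)
      (fun t _ => (hd t).differentiableAt.differentiableWithinAt) fun t ht => ?_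
    rw [interior_Icc] at ht
    rw [(hd t).deriv]
    exact hmono _ ⟨hx.1, hx.2.1, hx.2.2.1.trans ht.1, ht.2⟩
  have hle : x 2 ≤ h := hx.2.2.2.le
  have h1 := hanti ⟨le_rfl, hle⟩ ⟨hle, le_rfl⟩ hle
  simpa only [ha.eq_one_top, bpt_coord] using h1

/-- Under the non-trapping assumptions, the Rellich integrand controls `∂H/∂x₃` and, where
`∂a/∂x₃ < 0`, also `curl_α H`. -/
theorem rellichIntegrand_lower_bound (hh : 0 < h) {δ Mt Mz : ℝ} (hδ : 0 < δ) {x : R3}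
    (hax : 1 ≤ a x) (hT : pdR 0 a x ^ 2 + pdR 1 a x ^ 2 ≤ Mt ^ 2)
    (hZ : |pdR 2 a x| ≤ Mz) :
    x 2 * -pdR 2 a x * nsq (curlA α H x) +
      (2 - 1 / δ) * (Complex.normSq (pdV 2 H x 0) + Complex.normSq (pdV 2 H x 1)) +
      (2 - δ * Mt ^ 2 * h ^ 2 / 2 - √2 * h * Mz) * Complex.normSq (pdV 2 H x 2) ≤
    rellichIntegrand α a H x - (δ * Mt ^ 2 + √2 * Mz / h) * weightIntegrand h H x := by
  have h2 : √2 ^ 2 = 2 := Real.sq_sqrt (by norm_num)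
  have h2p : 0 < √2 := by positivity
  have hMz : 0 ≤ Mz := (abs_nonneg _).trans hZ
  have hlam : 0 ≤ δ * Mt ^ 2 + √2 * Mz / h := by positivity
  have hw := mul_le_mul_of_nonneg_left
    (weight_le hh (riccatiWeight h (x 2)) (H x 2) (pdV 2 H x 2)) hlam
  have h0 := neg_le_two_mul_re hδ (pdR 0 a x) (H x 2) (pdV 2 H x 0)
  have h1 := neg_le_two_mul_re hδ (pdR 1 a x) (H x 2) (pdV 2 H x 1)
  have h3 := neg_le_two_mul_re_of_abs_le (s := √2 / h) (by positivity) hZ (H x 2) (pdV 2 H x 2)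
  have h4 : δ * (pdR 0 a x ^ 2 + pdR 1 a x ^ 2) * Complex.normSq (H x 2) ≤
      δ * Mt ^ 2 * Complex.normSq (H x 2) := by
    have := Complex.normSq_nonneg (H x 2)
    gcongr
  have h5 : 2 * nsq (pdV 2 H x) ≤ 2 * a x * nsq (pdV 2 H x) := by
    nlinarith [nsq_nonneg (pdV 2 H x)]
  have h6 : 1 / (√2 / h) = √2 * h / 2 := by
    rw [one_div_div]
    field_simp
    linarith
  have h7 : (δ * Mt ^ 2 + √2 * Mz / h) * (h ^ 2 / 2 * Complex.normSq (pdV 2 H x 2)) =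
      (δ * Mt ^ 2 * h ^ 2 / 2 + √2 * h * Mz / 2) * Complex.normSq (pdV 2 H x 2) := by
    field_simp
  have h8 : nsq (pdV 2 H x) = Complex.normSq (pdV 2 H x 0) + Complex.normSq (pdV 2 H x 1) +
      Complex.normSq (pdV 2 H x 2) := Fin.sum_univ_three _
  rw [rellichIntegrand, Fin.sum_univ_three, Complex.add_re, Complex.add_re,
    Complex.re_ofReal_mul, Complex.re_ofReal_mul, Complex.re_ofReal_mul]
  rw [← weightIntegrand, mul_sub, h7] at hw
  rw [h6] at h3
  rw [h8] at h5
  rw [h8]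
  linear_combination hw + h0 + h1 + h3 + h4 + h5

theorem IsHomSol.pdV_and_curlA_eq_zero (hh : 0 < h) (hα : α 2 = 0) (ha : EpsOK h a)
    (hnt : NonTrapping h a) (hH : IsHomSol h k α a H) :
    ∀ x ∈ Omg h, pdV 2 H x = 0 ∧ (pdR 2 a x < 0 → curlA α H x = 0) := by
  obtain ⟨hmono, -, δ, hδ, Mt, Mz, hT, hZ, hsmall⟩ := hnt
  have hδ0 : 0 < δ := by linarith
  have hc1 : 0 < 2 - 1 / δ := by
    have : 1 / δ < 2 := by
      rw [div_lt_iff₀ hδ0]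
      linarith
    linarith
  have hc2 : 0 < 2 - δ * Mt ^ 2 * h ^ 2 / 2 - √2 * h * Mz := by
    have h1 := mul_lt_mul_of_pos_right hsmall (pow_pos hh 2)
    have h2 : (δ / 2 * Mt ^ 2 + √2 / h * Mz) * h ^ 2 =
        δ * Mt ^ 2 * h ^ 2 / 2 + √2 * h * Mz := by
      field_simp
    have h3 : 2 / h ^ 2 * h ^ 2 = 2 := by field_simp
    linarith
  have hlow (x : R3) (hx : x ∈ Omg h) := rellichIntegrand_lower_bound (α := α) (H := H) hh hδ0
    (ha.one_le hmono hx) (hT x hx) (hZ x hx)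
  set lam : ℝ := δ * Mt ^ 2 + √2 * Mz / h
  have hA (x : R3) (hx : x ∈ Omg h) : 0 ≤ x 2 * -pdR 2 a x * nsq (curlA α H x) :=
    mul_nonneg (mul_nonneg hx.2.2.1.le (neg_nonneg.2 (hmono x hx))) (nsq_nonneg _)
  have hB (x : R3) : 0 ≤ (2 - 1 / δ) *
      (Complex.normSq (pdV 2 H x 0) + Complex.normSq (pdV 2 H x 1)) :=
    mul_nonneg hc1.le (add_nonneg (Complex.normSq_nonneg _) (Complex.normSq_nonneg _))
  have hC (x : R3) : 0 ≤ (2 - δ * Mt ^ 2 * h ^ 2 / 2 - √2 * h * Mz) *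
      Complex.normSq (pdV 2 H x 2) := mul_nonneg hc2.le (Complex.normSq_nonneg _)
  have hJ := continuous_rellichIntegrand (α := α) ha.smooth hH.smooth
  have hW := continuousOn_weightIntegrand hh hH.smooth
  have hWi : IntegrableOn (weightIntegrand h H) (Omg h) :=
    (hW.integrableOn_compact (isCompact_closedCell h)).mono_set (Omg_subset_closedCell h)
  have hint : ∫ x in Omg h, (rellichIntegrand α a H x - lam * weightIntegrand h H x) ≤ 0 := by
    rw [integral_sub hJ.integrableOn_Omg (hWi.const_mul lam), integral_const_mul,
      integral_weightIntegrand hh hH.smooth hH.bc_normal, mul_zero, sub_zero]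
    exact hH.integral_rellichIntegrand hh hα ha
  have hzero := eqOn_zero_of_setIntegral_nonpos (isOpen_Omg h)
    (hJ.continuousOn.sub ((continuousOn_const (c := lam)).mul
      (hW.mono (Omg_subset_closedCell h))))
    (hJ.integrableOn_Omg.sub (hWi.const_mul lam))
    (fun x hx => (add_nonneg (add_nonneg (hA x hx) (hB x)) (hC x)).trans (hlow x hx)) hint
  intro x hx
  have h1 := (hlow x hx).trans (hzero x hx).le
  have h2 := hA x hx
  have h3 := hB x
  have h4 := hC x
  have h5 : Complex.normSq (pdV 2 H x 0) + Complex.normSq (pdV 2 H x 1) = 0 :=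
    (mul_eq_zero.1 (le_antisymm (by linarith) h3)).resolve_left hc1.ne'
  have h6 : Complex.normSq (pdV 2 H x 2) = 0 :=
    (mul_eq_zero.1 (le_antisymm (by linarith) h4)).resolve_left hc2.ne'
  refine ⟨dotc_self_eq_zero ?_, fun hneg => dotc_self_eq_zero ?_⟩
  · rw [nsq, Fin.sum_univ_three, h5, h6, add_zero]
  · have h7 : x 2 * -pdR 2 a x * nsq (curlA α H x) = 0 := le_antisymm (by linarith) h2
    exact (mul_eq_zero.1 h7).resolve_left (mul_pos hx.2.2.1 (neg_pos.2 hneg)).ne'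

end Coercivity

section UniqueContinuation

variable {h k : ℝ} {α : R3} {a : R3 → ℝ} {H : R3 → C3}

/-- The modes with `|n + α| = k`, for which `β_n = 0`, are finitely many. -/
theorem exists_finset_betaN_ne_zero (hk : 0 < k) (α : R3) :
    ∃ S : Finset (ℤ × ℤ), ∀ n, n ∉ S → betaN k α n ≠ 0 := by
  refine ⟨Finset.Icc ⌈-k - α 0⌉ ⌊k - α 0⌋ ×ˢ Finset.Icc ⌈-k - α 1⌉ ⌊k - α 1⌋, fun n hn hb => hn ?_⟩
  have h1 := (I_mul_betaN k α n).2.2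
  rw [hb, mul_zero, zero_pow two_ne_zero, eq_comm, Complex.ofReal_eq_zero] at h1
  simp only [freq, Matrix.cons_val_zero, Matrix.cons_val_one] at h1
  have h2 := abs_le_of_sq_le_sq' (a := n.1 + α 0) (b := k)
    (by linarith [sq_nonneg (n.2 + α 1)]) hk.le
  have h3 := abs_le_of_sq_le_sq' (a := n.2 + α 1) (b := k)
    (by linarith [sq_nonneg (n.1 + α 0)]) hk.le
  simp only [Finset.mem_product, Finset.mem_Icc, Int.ceil_le, Int.le_floor]
  refine ⟨⟨?_, ?_⟩, ⟨?_, ?_⟩⟩ <;> linarith [h2.1, h2.2, h3.1, h3.2]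

theorem IsHomSol.eq_zero_of_curlA_eq_zero (hk : 0 < k) (hH : IsHomSol h k α a H) {U : Set R3}
    (hU : IsOpen U) (hsub : U ⊆ Omg h) (hz : ∀ x ∈ U, curlA α H x = 0) : ∀ x ∈ U, H x = 0 := by
  intro x hx
  have h1 : fluxS α a H =ᶠ[nhds x] fun _ => 0 := by
    filter_upwards [hU.mem_nhds hx] with y hy
    rw [fluxS, hz y hy, smul_zero]
  have h2 (i j : Fin 3) : pdC i (fun y => fluxS α a H y j) x = 0 := by
    have h3 : (fun y => fluxS α a H y j) =ᶠ[nhds x] fun _ => 0 :=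
      h1.mono fun y hy => congrFun hy j
    rw [pdC, h3.fderiv_eq, ← pdC, pdC_const]
  have h3 : curlA α (fluxS α a H) x = 0 := by
    ext i
    fin_cases i <;> simp [curlA, curlF, h2, h1.eq_of_nhds, crossC]
  rw [hH.curlA_fluxS (hsub hx)] at h3
  exact (smul_eq_zero.1 h3).resolve_left (pow_ne_zero 2 (Complex.ofReal_ne_zero.2 hk.ne'))

theorem eq_top_of_pdV_eq_zero (hH : ContDiff ℝ 1 H) (hV : ∀ x ∈ Omg h, pdV 2 H x = 0)
    {x : R3} (hx : x ∈ Omg h) : H x = H (bpt (x 0, x 1) h) := by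
  ext j
  have hd (t : ℝ) : HasDerivAt (fun t => H (bpt (x 0, x 1) t) j)
      (pdV 2 H (bpt (x 0, x 1) t) j) t :=
    ((hH.comp_apply j).differentiable (by norm_num) _).hasFDerivAt.comp_hasDerivAt t
      (hasDerivAt_bpt _ t)
  have h1 := constant_of_derivWithin_zero (f := fun t => H (bpt (x 0, x 1) t) j)
    (a := x 2) (b := h) (fun t _ => (hd t).differentiableAt.differentiableWithinAt) ?_ h
    ⟨hx.2.2.2.le, le_rfl⟩
  · simpa only [bpt_coord] using h1.symm
  · intro t ht
    rw [(hd t).hasDerivWithinAt.derivWithin (uniqueDiffOn_Icc hx.2.2.2 t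
      (Set.Ico_subset_Icc_self ht)), hV (bpt (x 0, x 1) t)
      ⟨hx.1, hx.2.1, hx.2.2.1.trans_le ht.1, ht.2⟩]
    rfl

theorem IsHomSol.fcoeff_eq_zero (hh : 0 < h) (hH : IsHomSol h k α a H)
    (hV : ∀ x ∈ Omg h, pdV 2 H x = 0) {n : ℤ × ℤ} (hn : betaN k α n ≠ 0) : fcoeff H n h = 0 := by
  have hV' : Set.EqOn (pdV 2 H) (fun _ => 0) (closure (Omg h)) :=
    Set.EqOn.closure hV (contDiff_pdV hH.smooth 2).continuous continuous_const
  have h1 : fcoeff (pdV 2 H) n h = 0 := by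
    ext j
    rw [fcoeff, setIntegral_eq_zero_of_forall_eq_zero, mul_zero, Pi.zero_apply]
    intro p hp
    have h2 := hV' (x := bpt p h) (by
      rw [closure_Omg hh]
      exact bpt_mem_closedCell hp ⟨hh.le, le_rfl⟩)
    exact mul_eq_zero_of_left (congrFun h2 j) _
  rw [hH.fcoeff_pdV] at h1
  exact (smul_eq_zero.1 h1).resolve_left (mul_ne_zero Complex.I_ne_zero hn)

theorem IsHomSol.eq_zero_of_pdV_eq_zero (hh : 0 < h) (hk : 0 < k) (hH : IsHomSol h k α a H)
    (hV : ∀ x ∈ Omg h, pdV 2 H x = 0) {U : Set R3} (hU : IsOpen U) (hne : U.Nonempty)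
    (hsub : U ⊆ Omg h) (hz : ∀ x ∈ U, H x = 0) : ∀ x ∈ Omg h, H x = 0 := by
  intro x hx
  have htop {y : R3} (hy : y ∈ Omg h) := eq_top_of_pdV_eq_zero (hH.smooth.of_le (by norm_num)) hV hy
  obtain ⟨S, hS⟩ := exists_finset_betaN_ne_zero hk α
  obtain ⟨u, hu⟩ := hne
  rw [htop hx]
  ext j
  refine eq_zero_on_sq2_of_finite_of_open (U := {p | bpt p (u 2) ∈ U})
    (continuous_trace hH.smooth.continuous h j) S (fun n hn => ?_)
    (hU.preimage (continuous_bpt_left (u 2))) ⟨(u 0, u 1), ?_⟩ (fun p hp => ?_) (fun p hp => ?_)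
    (x 0, x 1) ⟨hx.1, hx.2.1⟩
  · rw [← fcoeff_eq_sqCoeff, hH.fcoeff_eq_zero hh hV (hS n hn), Pi.zero_apply]
  · simpa only [Set.mem_ofPred_eq, bpt_coord] using hu
  · exact ⟨(hsub hp).1, (hsub hp).2.1⟩
  · exact congrFun ((htop (hsub hp)).symm.trans (hz _ hp)) j

end UniqueContinuation

/-- Under the non-trapping assumptions (a), (b), (c) on `ε_r⁻¹`, every
homogeneous radiating solution of the scattering problem vanishes identically in `Ω`,
for every wave number `k > 0`. -/
theorem uniqueness_for_all_wavenumbers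
    (h : ℝ) (hh : 0 < h) (α : R3) (hα : α 2 = 0)
    (εinv : R3 → ℝ) (hε : EpsOK h εinv) (hnt : NonTrapping h εinv)
    (k : ℝ) (hk : 0 < k)
    (H : R3 → C3) (hH : IsHomSol h k α εinv H) :
    ∀ x ∈ Omg h, H x = 0 := by
  have key := hH.pdV_and_curlA_eq_zero hh hα hε hnt
  obtain ⟨U, hU, hne, hsub, hneg⟩ := hnt.2.1
  have hz := hH.eq_zero_of_curlA_eq_zero hk hU hsub fun x hx => (key x (hsub hx)).2 (hneg x hx)
  exact hH.eq_zero_of_pdV_eq_zero hh hk (fun x hx => (key x hx).1) hU hne hsub hz
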